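/- arXiv:1604.08435 — 4 statements merged into one kernel-verified Lean document; each statement's English description precedes it below -/
import Mathlib

section
/- Let R be a standard-graded affine domain over a field k and let f, f₁, …, fₙ ∈ R be homogeneous with f nonzero. If f, fₙ is an R-regular sequence, then there is an isomorphism of graded R-modules Syz_R(f·f₁, …, f·f_{n-1}, fₙ) ≅ Syz_R(f₁, …, fₙ)(-deg f). -/
noncomputable section

/-- The linear map sending a tuple `s` to `∑ i, s i * g i`. -/
def syzMap {R : Type*} [CommRing R] {N : ℕ} (g : Fin N → R) : (Fin N → R) →ₗ[R] R where
  toFun s := ∑ i, s i * g i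
  map_add' := by intro s t; simp [add_mul, Finset.sum_add_distrib]
  map_smul' := by intro c s; simp [Finset.mul_sum, mul_assoc]

/-- The first syzygy module of the elements `g 0, …, g (N-1)` of `R`:
the submodule of tuples `s` with `∑ i, s i * g i = 0`. -/
def Syz {R : Type*} [CommRing R] {N : ℕ} (g : Fin N → R) : Submodule R (Fin N → R) :=
  LinearMap.ker (syzMap g)

/-- `s` is a homogeneous element of total degree `t` of a (syzygy sub)module of
`R(-D 0) ⊕ ⋯ ⊕ R(-D (N-1))`, i.e. the `i`-th component lies in `𝒜 (t - D i)`
(interpreted as `0` when `t - D i < 0`). -/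
def IsHomogTuple {k R : Type*} [CommSemiring k] [CommRing R] [Algebra k R]
    (𝒜 : ℕ → Submodule k R) {N : ℕ} (D : Fin N → ℕ) (t : ℤ) (s : Fin N → R) : Prop :=
  ∀ i, s i = 0 ∨ ∃ c : ℕ, (c : ℤ) = t - D i ∧ s i ∈ 𝒜 c

theorem mem_of_mul_mem_of_homogeneous {k R : Type*} [CommRing k] [CommRing R] [IsDomain R]
    [Algebra k R] (𝒜 : ℕ → Submodule k R) [GradedAlgebra 𝒜] {f x : R} {e c : ℕ}
    (hf : f ∈ 𝒜 e) (hfne : f ≠ 0) (hx : x ≠ 0) (hfx : f * x ∈ 𝒜 c) :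
    ∃ j, c = e + j ∧ x ∈ 𝒜 j := by
  have hcomp (j : ℕ) : (DirectSum.decompose 𝒜 (f * x) (e + j) : R) =
      f * DirectSum.decompose 𝒜 x j := DirectSum.coe_decompose_mul_add_of_left_mem 𝒜 hf
  obtain ⟨j, hj⟩ : ∃ j, (DirectSum.decompose 𝒜 x j : R) ≠ 0 := by
    by_contra! h
    refine hx ((DirectSum.decompose 𝒜).injective ?_)
    ext j
    simpa using h j
  have hc : c = e + j := by
    by_contra hne
    have h := hcomp j
    rw [DirectSum.decompose_of_mem_ne 𝒜 hfx hne] at h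
    exact mul_ne_zero hfne hj h.symm
  refine ⟨j, hc, ?_⟩
  have h := hcomp j
  rw [← hc, DirectSum.decompose_of_mem_same 𝒜 hfx] at h
  rw [mul_left_cancel₀ hfne h]
  exact SetLike.coe_mem _

theorem mem_Syz {R : Type*} [CommRing R] {N : ℕ} {g s : Fin N → R} :
    s ∈ Syz g ↔ ∑ i, s i * g i = 0 := Iff.rfl

/-- Multiplication of the last coordinate by `f`. -/
def mulLast {R : Type*} [CommRing R] {n : ℕ} (f : R) :
    (Fin (n + 1) → R) →ₗ[R] (Fin (n + 1) → R) where
  toFun s := Fin.snoc (fun i : Fin n => s i.castSucc) (f * s (Fin.last n))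
  map_add' s t := by
    ext i
    refine Fin.lastCases ?_ (fun j => ?_) i <;> simp [mul_add]
  map_smul' c s := by
    ext i
    refine Fin.lastCases ?_ (fun j => ?_) i <;> simp [mul_left_comm]

@[simp]
theorem mulLast_castSucc {R : Type*} [CommRing R] {n : ℕ} (f : R) (s : Fin (n + 1) → R)
    (i : Fin n) : mulLast f s i.castSucc = s i.castSucc := by
  simp [mulLast]

@[simp]
theorem mulLast_last {R : Type*} [CommRing R] {n : ℕ} (f : R) (s : Fin (n + 1) → R) :
    mulLast f s (Fin.last n) = f * s (Fin.last n) := by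
  simp [mulLast]

theorem mulLast_injective {R : Type*} [CommRing R] [IsDomain R] {n : ℕ} {f : R} (hf : f ≠ 0) :
    Function.Injective (mulLast (n := n) f) := by
  intro s t h
  ext i
  refine Fin.lastCases ?_ (fun j => ?_) i
  · simpa [hf] using congrFun h (Fin.last n)
  · simpa using congrFun h j.castSucc

theorem sum_mulLast_mul_snoc {R : Type*} [CommRing R] {n : ℕ} (f : R) (F s : Fin (n + 1) → R) :
    ∑ i, mulLast f s i *
        (Fin.snoc (fun i : Fin n => f * F i.castSucc) (F (Fin.last n)) : Fin (n + 1) → R) i =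
      f * ∑ i, s i * F i := by
  simp [Fin.sum_univ_castSucc, mul_add, Finset.mul_sum, mul_left_comm, mul_assoc]

theorem mulLast_mem_Syz {R : Type*} [CommRing R] {n : ℕ} (f : R) {F s : Fin (n + 1) → R}
    (hs : s ∈ Syz F) :
    mulLast f s ∈ Syz (Fin.snoc (fun i : Fin n => f * F i.castSucc) (F (Fin.last n))) := by
  rw [mem_Syz] at hs ⊢
  rw [sum_mulLast_mul_snoc, hs, mul_zero]

theorem exists_mulLast_eq {R : Type*} [CommRing R] [IsDomain R] {n : ℕ} {f : R} (hf : f ≠ 0)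
    {F u : Fin (n + 1) → R}
    (hreg : ∀ x : R, F (Fin.last n) * x ∈ Ideal.span {f} → x ∈ Ideal.span {f})
    (hu : u ∈ Syz (Fin.snoc (fun i : Fin n => f * F i.castSucc) (F (Fin.last n)))) :
    ∃ s ∈ Syz F, mulLast f s = u := by
  rw [mem_Syz] at hu
  have hlast : u (Fin.last n) ∈ Ideal.span {f} := by
    apply hreg
    rw [Ideal.mem_span_singleton]
    refine ⟨-∑ i : Fin n, u i.castSucc * F i.castSucc, ?_⟩
    simp only [Fin.sum_univ_castSucc, Fin.snoc_castSucc, Fin.snoc_last, mul_left_comm _ f,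
      ← Finset.mul_sum] at hu
    linear_combination hu
  obtain ⟨y, hy⟩ := Ideal.mem_span_singleton.mp hlast
  have hsu : mulLast f (Fin.snoc (fun i : Fin n => u i.castSucc) y) = u := by
    ext i
    refine Fin.lastCases ?_ (fun j => ?_) i <;> simp [hy]
  refine ⟨_, ?_, hsu⟩
  rw [← hsu, sum_mulLast_mul_snoc] at hu
  exact (mul_eq_zero.mp hu).resolve_left hf

theorem isHomogTuple_mulLast_iff {k R : Type*} [CommRing k] [CommRing R] [IsDomain R]
    [Algebra k R] (𝒜 : ℕ → Submodule k R) [GradedAlgebra 𝒜] {n : ℕ} {f : R} {e : ℕ}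
    (hf : f ∈ 𝒜 e) (hfne : f ≠ 0) (d : Fin (n + 1) → ℕ) (t : ℤ) (s : Fin (n + 1) → R) :
    IsHomogTuple 𝒜 (Fin.snoc (fun i : Fin n => d i.castSucc + e) (d (Fin.last n))) t
        (mulLast f s) ↔ IsHomogTuple 𝒜 d (t - (e : ℤ)) s := by
  unfold IsHomogTuple
  rw [Fin.forall_fin_succ', Fin.forall_fin_succ']
  simp only [mulLast_castSucc, mulLast_last, Fin.snoc_castSucc, Fin.snoc_last, Nat.cast_add]
  refine and_congr (forall_congr' fun i => ?_) ⟨?_, ?_⟩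
  · rw [add_comm (d i.castSucc : ℤ), sub_sub]
  · rintro (h | ⟨c, hc, hmem⟩)
    · exact Or.inl ((mul_eq_zero.mp h).resolve_left hfne)
    · by_cases hx : s (Fin.last n) = 0
      · exact Or.inl hx
      · obtain ⟨j, rfl, hj⟩ := mem_of_mul_mem_of_homogeneous 𝒜 hf hfne hx hmem
        exact Or.inr ⟨j, by push_cast at hc; linarith, hj⟩
  · rintro (h | ⟨c, hc, hmem⟩)
    · exact Or.inl (by rw [h, mul_zero])
    · exact Or.inr ⟨e + c, by push_cast; linarith, SetLike.mul_mem_graded hf hmem⟩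

/-- Let `R` be a standard-graded affine domain over a field `k` and let
`f, f₁, …, f_{n+1}` be homogeneous with `f` nonzero.  If `f, f_{n+1}` is an
`R`-regular sequence, then there is an isomorphism of graded `R`-modules
`Syz_R(f·f₁, …, f·fₙ, f_{n+1}) ≅ Syz_R(f₁, …, f_{n+1})(-deg f)`. -/
theorem stmt2 (k : Type*) [Field k] (R : Type*) [CommRing R] [IsDomain R] [Algebra k R]
    (𝒜 : ℕ → Submodule k R) [GradedAlgebra 𝒜]
    -- `R` is standard-graded and affine over `k`:
    (hstd : Algebra.adjoin k (𝒜 1 : Set R) = ⊤) (haff : (𝒜 1).FG)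
    (n : ℕ) (f : R) (F : Fin (n + 1) → R) (e : ℕ) (d : Fin (n + 1) → ℕ)
    (hf : f ∈ 𝒜 e) (hfne : f ≠ 0) (hF : ∀ i, F i ∈ 𝒜 (d i))
    -- `f, F (Fin.last n)` is an `R`-regular sequence:
    (hreg1 : ∀ x : R, f * x = 0 → x = 0)
    (hreg2 : ∀ x : R, F (Fin.last n) * x ∈ Ideal.span {f} → x ∈ Ideal.span {f})
    (hreg3 : Ideal.span {f, F (Fin.last n)} ≠ ⊤) :
    ∃ φ : Syz (Fin.snoc (fun i : Fin n => f * F i.castSucc) (F (Fin.last n))) ≃ₗ[R] Syz F,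
      ∀ (t : ℤ) (s : Syz (Fin.snoc (fun i : Fin n => f * F i.castSucc) (F (Fin.last n)))),
        IsHomogTuple 𝒜 (Fin.snoc (fun i : Fin n => d i.castSucc + e) (d (Fin.last n))) t s.1 ↔
          IsHomogTuple 𝒜 d (t - (e : ℤ)) (φ s).1 := by
  let ψ := LinearEquiv.ofBijective
    ((mulLast f).restrict fun s hs => mulLast_mem_Syz f (F := F) hs)
    ⟨fun s t h => Subtype.ext (mulLast_injective hfne (congrArg Subtype.val h)), fun u => by
      obtain ⟨s, hs, hsu⟩ := exists_mulLast_eq hfne hreg2 u.2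
      exact ⟨⟨s, hs⟩, Subtype.ext hsu⟩⟩
  refine ⟨ψ.symm, fun t u => ?_⟩
  obtain ⟨s, rfl⟩ := ψ.surjective u
  rw [LinearEquiv.symm_apply_apply]
  exact isHomogTuple_mulLast_iff 𝒜 hf hfne d t s.1
end
end

section
/- With R = k[U,V] graded by deg U = a, deg V = b, F₁,F₂,F₃ homogeneous coprime of degrees d₁,d₂,d₃, I = (F₁,F₂,F₃), and Syz_R(F₁,F₂,F₃) ≅ R(-α)⊕R(-β), the k-dimension of R/I equals (Q(d₁,d₂,d₃) + (α-β)²)/(4ab), where Q(r,s,t) = 2rs + 2rt + 2st - r² - s² - t². -/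
/-- In a Noetherian factorial domain of dimension at most two, a nonzero ideal whose elements have
no common prime divisor defines a quotient of dimension zero. -/
theorem krullDimLE_zero_quotient_of_no_common_prime {R : Type*} [CommRing R] [IsDomain R]
    [IsNoetherianRing R] [UniqueFactorizationMonoid R] (hdim : ringKrullDim R ≤ 2)
    {I : Ideal R} (hI : I ≠ ⊥) (h : ∀ p : R, Prime p → ¬ I ≤ Ideal.span {p}) :
    Ring.KrullDimLE 0 (R ⧸ I) := by
  refine Ring.KrullDimLE.mk₀ fun J hJ => ?_
  set P := J.comap (Ideal.Quotient.mk I) with hP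
  have hPprime : P.IsPrime := inferInstance
  have hIP : I ≤ P := fun x hx => by
    simp [hP, Ideal.mem_comap, Ideal.Quotient.eq_zero_iff_mem.mpr hx]
  suffices hmax : P.IsMaximal by
    have hmap : P.map (Ideal.Quotient.mk I) = J :=
      Ideal.map_comap_of_surjective _ Ideal.Quotient.mk_surjective J
    rw [← hmap]
    exact Ideal.IsMaximal.map_of_surjective_of_ker_le Ideal.Quotient.mk_surjective
      (by rwa [Ideal.mk_ker])
  obtain ⟨p, hpP, hp⟩ := hPprime.exists_mem_prime_of_ne_bot
    (fun h0 => hI (le_bot_iff.mp (h0 ▸ hIP)))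
  obtain ⟨M, hM, hPM⟩ := Ideal.exists_le_maximal P hPprime.ne_top
  rcases hPM.eq_or_lt with heq | hlt
  · rwa [heq]
  exfalso
  have hpp : (Ideal.span {p}).IsPrime := (Ideal.span_singleton_prime hp.ne_zero).mpr hp
  have h0p : (⊥ : Ideal R) < Ideal.span {p} := by
    rw [bot_lt_iff_ne_bot, Ne, Ideal.span_singleton_eq_bot]
    exact hp.ne_zero
  have hpP' : Ideal.span {p} < P := by
    refine lt_of_le_of_ne ((Ideal.span_singleton_le_iff_mem _).mpr hpP) fun he => h p hp ?_
    rw [he]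
    exact hIP
  have h1 := Order.add_one_le_of_lt (Ideal.height_strict_mono_of_isPrime h0p)
  have h2 := Order.add_one_le_of_lt (Ideal.height_strict_mono_of_isPrime hpP')
  have h3 := Order.add_one_le_of_lt (Ideal.height_strict_mono_of_isPrime hlt)
  have h4 : M.height ≤ 2 := by
    exact WithBot.coe_le_coe.mp ((Ideal.height_le_ringKrullDim_of_ne_top hM.ne_top).trans hdim)
  have h5 : (3 : ℕ∞) ≤ 2 := calc
    (3 : ℕ∞) = 0 + 1 + 1 + 1 := by norm_num
    _ ≤ (⊥ : Ideal R).height + 1 + 1 + 1 := by gcongr; exact zero_le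
    _ ≤ (Ideal.span {p}).height + 1 + 1 := by gcongr
    _ ≤ P.height + 1 := by gcongr
    _ ≤ M.height := h3
    _ ≤ 2 := h4
  exact absurd h5 (by decide)

/-- Rank-nullity for the restriction of a linear map to a subspace. -/
theorem finrank_map_add_finrank_inf_ker {K V V' : Type*} [Field K] [AddCommGroup V] [Module K V]
    [AddCommGroup V'] [Module K V'] (f : V →ₗ[K] V') (S : Submodule K V)
    [FiniteDimensional K S] :
    Module.finrank K (S.map f) + Module.finrank K (S ⊓ LinearMap.ker f : Submodule K V)
      = Module.finrank K S := by
  rw [← LinearMap.finrank_range_add_finrank_ker (f.domRestrict S), LinearMap.range_domRestrict,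
    LinearMap.ker_domRestrict, ← Submodule.finrank_map_subtype_eq, Submodule.map_comap_subtype]

/-- The submodule of families with components in `p i` is the product of the `p i`. -/
def Submodule.piEquivPi {K ι : Type*} {V : ι → Type*} [Semiring K] [∀ i, AddCommMonoid (V i)]
    [∀ i, Module K (V i)] (p : ∀ i, Submodule K (V i)) :
    Submodule.pi Set.univ p ≃ₗ[K] ∀ i, p i where
  toFun x i := ⟨x.1 i, x.2 i trivial⟩
  invFun y := ⟨fun i => y i, fun i _ => (y i).2⟩
  map_add' _ _ := rfl
  map_smul' _ _ := rfl
  left_inv _ := rfl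
  right_inv _ := rfl

/-- The submodule of pairs with components in `p` and `q` is the product of `p` and `q`. -/
def Submodule.prodEquivProd {K V V' : Type*} [Semiring K] [AddCommMonoid V] [AddCommMonoid V']
    [Module K V] [Module K V'] (p : Submodule K V) (q : Submodule K V') :
    p.prod q ≃ₗ[K] p × q where
  toFun x := (⟨x.1.1, x.2.1⟩, ⟨x.1.2, x.2.2⟩)
  invFun y := ⟨(y.1, y.2), y.1.2, y.2.2⟩
  map_add' _ _ := rfl
  map_smul' _ _ := rfl
  left_inv _ := rfl
  right_inv _ := rfl

section HilbertSeries

open PowerSeries in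
theorem one_sub_X_pow_mul_mk_dvd {a : ℕ} (ha : 1 ≤ a) :
    (1 - (X : PowerSeries ℤ) ^ a) * PowerSeries.mk (fun n => if a ∣ n then (1 : ℤ) else 0) = 1 := by
  ext n
  rw [sub_mul, one_mul, map_sub, PowerSeries.coeff_X_pow_mul', PowerSeries.coeff_mk, coeff_one]
  by_cases h : a ≤ n
  · rw [if_pos h, coeff_mk, if_neg (by omega : n ≠ 0)]
    simp only [(Nat.dvd_sub_iff_left h dvd_rfl), sub_self]
  · have : a ∣ n ↔ n = 0 := ⟨fun hd => Nat.eq_zero_of_dvd_of_lt hd (by omega), by rintro rfl; simp⟩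
    simp [h, this]

open Polynomial in
/-- The value at `1` of `(1 - X ^ d₀ - X ^ d₁ - X ^ d₂ + X ^ α + X ^ β) / ((1 - X ^ a) (1 - X ^ b))`,
when this is a polynomial. -/
theorem eval_one_of_mul_eq (a b d₀ d₁ d₂ α β : ℕ) (H : ℤ[X])
    (h : (1 - X ^ a) * (1 - X ^ b) * H = 1 - X ^ d₀ - X ^ d₁ - X ^ d₂ + X ^ α + X ^ β) :
    4 * (a : ℤ) * b * H.eval 1 =
      2 * d₀ * d₁ + 2 * d₀ * d₂ + 2 * d₁ * d₂ - d₀ ^ 2 - d₁ ^ 2 - d₂ ^ 2 + (α - β) ^ 2 := by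
  have key (n : ℕ) : (n : ℤ) * ((n - 1 : ℕ) : ℤ) = n ^ 2 - n := by
    cases n <;> simp; ring
  have h1 := congrArg (fun p => (derivative p).eval 1) h
  have h2 := congrArg (fun p => (derivative (derivative p)).eval 1) h
  simp [derivative_X_pow, key] at h1 h2
  grind

/-- If `p` has generating series `1 / ((1 - X ^ a) (1 - X ^ b))` and the combination of shifts
of `p` below vanishes in degrees at least `M`, this computes the sum of its values. -/
theorem sum_shifts_eq {a b : ℕ} {p : ℤ → ℤ} (hneg : ∀ n < 0, p n = 0)
    (hp : (1 - PowerSeries.X ^ a) * (1 - PowerSeries.X ^ b) *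
      PowerSeries.mk (fun n : ℕ => p n) = 1) (d₀ d₁ d₂ α β M : ℕ)
    (hM : ∀ n : ℕ, M ≤ n → p n - p (n - d₀) - p (n - d₁) - p (n - d₂) + p (n - α) + p (n - β) = 0) :
    4 * (a : ℤ) * b * ∑ n ∈ Finset.range M,
        (p n - p (n - d₀) - p (n - d₁) - p (n - d₂) + p (n - α) + p (n - β)) =
      2 * d₀ * d₁ + 2 * d₀ * d₂ + 2 * d₁ * d₂ - d₀ ^ 2 - d₁ ^ 2 - d₂ ^ 2 + (α - β) ^ 2 := by
  set P : PowerSeries ℤ := PowerSeries.mk (fun n : ℕ => p n) with hP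
  set N : Polynomial ℤ := 1 - .X ^ d₀ - .X ^ d₁ - .X ^ d₂ + .X ^ α + .X ^ β with hN
  have hshift (d n : ℕ) : PowerSeries.coeff n (PowerSeries.X ^ d * P) = p (n - d) := by
    rw [PowerSeries.coeff_X_pow_mul', hP, PowerSeries.coeff_mk]
    split_ifs with hd
    · rw [Nat.cast_sub hd]
    · rw [hneg _ (by omega)]
  have hcoeff (n : ℕ) : PowerSeries.coeff n ((N : PowerSeries ℤ) * P) =
      p n - p (n - d₀) - p (n - d₁) - p (n - d₂) + p (n - α) + p (n - β) := by
    have h0 : PowerSeries.coeff n P = p n := PowerSeries.coeff_mk _ _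
    simp [hN, sub_mul, add_mul, hshift, h0]
  have htrunc : ((PowerSeries.trunc M ((N : PowerSeries ℤ) * P) : Polynomial ℤ) : PowerSeries ℤ) =
      (N : PowerSeries ℤ) * P := by
    ext n
    rw [Polynomial.coeff_coe, PowerSeries.coeff_trunc]
    split_ifs with h
    · rfl
    · rw [hcoeff, hM n (by omega)]
  have heval : (PowerSeries.trunc M ((N : PowerSeries ℤ) * P)).eval 1 = ∑ n ∈ Finset.range M,
        (p n - p (n - d₀) - p (n - d₁) - p (n - d₂) + p (n - α) + p (n - β)) := by
    rw [Polynomial.eval, PowerSeries.eval₂_trunc_eq_sum_range]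
    simp [hcoeff]
  rw [← heval]
  refine eval_one_of_mul_eq _ _ _ _ _ _ _ _ (Polynomial.coe_injective ℤ ?_)
  rw [Polynomial.coe_mul, htrunc, ← hN]
  calc _ = (N : PowerSeries ℤ) * ((1 - PowerSeries.X ^ a) * (1 - PowerSeries.X ^ b) * P) := by
        push_cast; ring
    _ = _ := by rw [hp, mul_one]

end HilbertSeries

open MvPolynomial

noncomputable section

section Weighted

variable {k : Type*} [Field k]

theorem weight_fin_two (a b : ℕ) (e : Fin 2 →₀ ℕ) :
    Finsupp.weight ![(a : ℤ), (b : ℤ)] e = ((a * e 0 + b * e 1 : ℕ) : ℤ) := by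
  simp [Finsupp.weight_eq_sum, Fin.sum_univ_two, mul_comm]

/-- The exponents of the monomials of weighted degree `n`. -/
def exponentsEquiv {a b : ℕ} (ha : 1 ≤ a) (hb : 1 ≤ b) (n : ℕ) :
    {e : Fin 2 →₀ ℕ | Finsupp.weight ![(a : ℤ), (b : ℤ)] e = n} ≃
      {x ∈ Finset.HasAntidiagonal.antidiagonal n | a ∣ x.1 ∧ b ∣ x.2} where
  toFun e := ⟨(a * e.1 0, b * e.1 1), by
    have h := e.2
    rw [Set.mem_ofPred_eq, weight_fin_two] at h
    simp; exact_mod_cast h⟩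
  invFun x := ⟨Finsupp.equivFunOnFinite.symm ![x.1.1 / a, x.1.2 / b], by
    obtain ⟨⟨x, y⟩, h⟩ := x
    simp only [Finset.mem_filter, Finset.HasAntidiagonal.mem_antidiagonal] at h
    rw [Set.mem_ofPred_eq, weight_fin_two]
    simp [Nat.mul_div_cancel' h.2.1, Nat.mul_div_cancel' h.2.2]
    exact_mod_cast h.1⟩
  left_inv e := by
    ext i
    fin_cases i <;> simp [Nat.mul_div_cancel_left _ ha, Nat.mul_div_cancel_left _ hb]
  right_inv x := by
    obtain ⟨⟨x, y⟩, h⟩ := x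
    simp only [Finset.mem_filter, Finset.HasAntidiagonal.mem_antidiagonal] at h
    simp [Nat.mul_div_cancel' h.2.1, Nat.mul_div_cancel' h.2.2]

theorem weightedHomogeneousSubmodule_eq_bot_of_neg (a b : ℕ) {n : ℤ} (hn : n < 0) :
    weightedHomogeneousSubmodule k ![(a : ℤ), (b : ℤ)] n = ⊥ := by
  refine (Submodule.eq_bot_iff _).mpr fun f hf => ?_
  ext e
  refine IsWeightedHomogeneous.coeff_eq_zero hf e ?_
  rw [weight_fin_two]
  omega

/-- The monomials form a basis of the space of weighted homogeneous polynomials. -/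
def weightedHomogeneousBasis {σ M : Type*} [AddCommMonoid M] (w : σ → M) (n : M) :
    Module.Basis {e : σ →₀ ℕ | Finsupp.weight w e = n} k (weightedHomogeneousSubmodule k w n) :=
  (basisRestrictSupport k _).map
    (LinearEquiv.ofEq _ _ (weightedHomogeneousSubmodule_eq_finsupp_supported k w n).symm)

theorem finiteDimensional_weightedHomogeneousSubmodule {a b : ℕ} (ha : 1 ≤ a) (hb : 1 ≤ b)
    (n : ℤ) : FiniteDimensional k (weightedHomogeneousSubmodule k ![(a : ℤ), (b : ℤ)] n) := by
  rcases lt_or_ge n 0 with hn | hn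
  · rw [weightedHomogeneousSubmodule_eq_bot_of_neg a b hn]
    infer_instance
  · lift n to ℕ using hn
    have := Finite.of_equiv _ (exponentsEquiv ha hb n).symm
    exact Module.Finite.of_basis (weightedHomogeneousBasis _ _)

theorem hilbertSeries_eq {a b : ℕ} (ha : 1 ≤ a) (hb : 1 ≤ b) :
    (1 - PowerSeries.X ^ a) * (1 - PowerSeries.X ^ b) * PowerSeries.mk (fun n : ℕ =>
      (Module.finrank k (weightedHomogeneousSubmodule k ![(a : ℤ), (b : ℤ)] n) : ℤ)) = 1 := by
  have h : PowerSeries.mk (fun n : ℕ =>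
      (Module.finrank k (weightedHomogeneousSubmodule k ![(a : ℤ), (b : ℤ)] n) : ℤ)) =
      PowerSeries.mk (fun n => if a ∣ n then (1 : ℤ) else 0) *
        PowerSeries.mk (fun n => if b ∣ n then (1 : ℤ) else 0) := by
    ext n
    rw [PowerSeries.coeff_mul, PowerSeries.coeff_mk,
      Module.finrank_eq_nat_card_basis (weightedHomogeneousBasis _ _),
      Nat.card_congr (exponentsEquiv ha hb n)]
    simp only [Nat.card_eq_fintype_card, Fintype.card_coe, Finset.card_filter, ite_and,
      PowerSeries.coeff_mk, ite_mul, one_mul, zero_mul]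
    push_cast
    rfl
  rw [h]
  calc _ = ((1 - PowerSeries.X ^ a) * PowerSeries.mk (fun n => if a ∣ n then (1 : ℤ) else 0)) *
      ((1 - PowerSeries.X ^ b) * PowerSeries.mk (fun n => if b ∣ n then (1 : ℤ) else 0)) := by ring
    _ = 1 := by rw [one_sub_X_pow_mul_mk_dvd ha, one_sub_X_pow_mul_mk_dvd hb, one_mul]

theorem weightedHomogeneousComponent_mul_of_right {σ M : Type*} [AddCommGroup M] {w : σ → M}
    {f : MvPolynomial σ k} {e : M} (hf : IsWeightedHomogeneous w f e) (c : MvPolynomial σ k)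
    (m : M) : weightedHomogeneousComponent w m (c * f) =
      weightedHomogeneousComponent w (m - e) c * f := by
  classical
  let _ := weightedGradedAlgebra k w
  have h := DirectSum.coe_decompose_mul_add_of_right_mem (weightedHomogeneousSubmodule k w)
    (a := c) (i := m - e) hf
  rw [sub_add_cancel] at h
  simp only [← weightedDecomposition.decompose'_apply]
  exact h

section Resolution

variable {a b : ℕ} {F : Fin 3 → MvPolynomial (Fin 2) k} {d : Fin 3 → ℕ}

/-- The homomorphism `R³ → R` with components `F`. -/
def relationMap (F : Fin 3 → MvPolynomial (Fin 2) k) :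
    (Fin 3 → MvPolynomial (Fin 2) k) →ₗ[k] MvPolynomial (Fin 2) k :=
  (Fintype.linearCombination (MvPolynomial (Fin 2) k) F).restrictScalars k

theorem relationMap_apply (u : Fin 3 → MvPolynomial (Fin 2) k) :
    relationMap F u = ∑ i, u i * F i := by
  simp [relationMap, Fintype.linearCombination_apply]

/-- The homomorphism `R² → R³` with columns `s` and `t`. -/
def syzygyMap (s t : Fin 3 → MvPolynomial (Fin 2) k) :
    MvPolynomial (Fin 2) k × MvPolynomial (Fin 2) k →ₗ[k] (Fin 3 → MvPolynomial (Fin 2) k) :=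
  ((LinearMap.toSpanSingleton (MvPolynomial (Fin 2) k) _ s).coprod
    (LinearMap.toSpanSingleton (MvPolynomial (Fin 2) k) _ t)).restrictScalars k

theorem syzygyMap_apply (s t : Fin 3 → MvPolynomial (Fin 2) k)
    (c : MvPolynomial (Fin 2) k × MvPolynomial (Fin 2) k) :
    syzygyMap s t c = c.1 • s + c.2 • t := by
  simp [syzygyMap]

theorem mem_span_triple_iff {f : MvPolynomial (Fin 2) k} :
    f ∈ Ideal.span {F 0, F 1, F 2} ↔ ∃ u : Fin 3 → MvPolynomial (Fin 2) k, ∑ i, u i * F i = f := by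
  have : ({F 0, F 1, F 2} : Set (MvPolynomial (Fin 2) k)) = Set.range F := by
    ext x
    simp [Fin.exists_fin_succ, eq_comm]
  rw [this, Ideal.mem_span_range_iff_exists_fun]

theorem map_relationMap_eq
    (hF : ∀ i, IsWeightedHomogeneous ![(a : ℤ), (b : ℤ)] (F i) ((d i : ℤ))) (n : ℤ) :
    (Submodule.pi Set.univ fun i =>
      weightedHomogeneousSubmodule k ![(a : ℤ), (b : ℤ)] (n - d i)).map (relationMap F) =
    weightedHomogeneousSubmodule k ![(a : ℤ), (b : ℤ)] n ⊓
      (Ideal.span {F 0, F 1, F 2}).restrictScalars k := by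
  ext f
  constructor
  · rintro ⟨u, hu, rfl⟩
    rw [relationMap_apply]
    refine ⟨Submodule.sum_mem _ fun i _ => ?_, mem_span_triple_iff.mpr ⟨u, rfl⟩⟩
    simpa using (show IsWeightedHomogeneous _ (u i) _ from hu i trivial).mul (hF i)
  · rintro ⟨hf, hfI⟩
    obtain ⟨u, rfl⟩ := mem_span_triple_iff.mp hfI
    refine ⟨fun i => weightedHomogeneousComponent _ (n - d i) (u i),
      fun i _ => weightedHomogeneousComponent_mem _ _ _, ?_⟩
    rw [relationMap_apply, ← weightedHomogeneousComponent_eq_self hf, map_sum]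
    exact Finset.sum_congr rfl fun i _ =>
      (weightedHomogeneousComponent_mul_of_right (hF i) _ _).symm

variable {α β : ℕ} {s t : Fin 3 → MvPolynomial (Fin 2) k}

theorem pi_inf_ker_relationMap_eq
    (hs : ∑ i, s i * F i = 0) (ht : ∑ i, t i * F i = 0)
    (hshom : ∀ i, IsWeightedHomogeneous ![(a : ℤ), (b : ℤ)] (s i) ((α : ℤ) - (d i : ℤ)))
    (hthom : ∀ i, IsWeightedHomogeneous ![(a : ℤ), (b : ℤ)] (t i) ((β : ℤ) - (d i : ℤ)))
    (hgen : ∀ u : Fin 3 → MvPolynomial (Fin 2) k, (∑ i, u i * F i = 0) →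
      ∃ c₁ c₂ : MvPolynomial (Fin 2) k, u = c₁ • s + c₂ • t) (n : ℤ) :
    (Submodule.pi Set.univ fun i =>
      weightedHomogeneousSubmodule k ![(a : ℤ), (b : ℤ)] (n - d i)) ⊓
        LinearMap.ker (relationMap F) =
    ((weightedHomogeneousSubmodule k ![(a : ℤ), (b : ℤ)] (n - α)).prod
      (weightedHomogeneousSubmodule k ![(a : ℤ), (b : ℤ)] (n - β))).map (syzygyMap s t) := by
  ext u
  constructor
  · rintro ⟨hu, hker⟩
    rw [SetLike.mem_coe, LinearMap.mem_ker, relationMap_apply] at hker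
    obtain ⟨c₁, c₂, rfl⟩ := hgen u hker
    refine ⟨(weightedHomogeneousComponent _ (n - α) c₁, weightedHomogeneousComponent _ (n - β) c₂),
      ⟨weightedHomogeneousComponent_mem _ _ _, weightedHomogeneousComponent_mem _ _ _⟩, ?_⟩
    rw [syzygyMap_apply]
    ext1 i
    rw [← weightedHomogeneousComponent_eq_self (hu i trivial)]
    simp [weightedHomogeneousComponent_mul_of_right (hshom i),
      weightedHomogeneousComponent_mul_of_right (hthom i)]
  · rintro ⟨⟨c₁, c₂⟩, ⟨h₁, h₂⟩, rfl⟩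
    rw [syzygyMap_apply]
    refine ⟨fun i _ => Submodule.add_mem _ ?_ ?_, ?_⟩
    · simpa using (show IsWeightedHomogeneous _ c₁ _ from h₁).mul (hshom i)
    · simpa using (show IsWeightedHomogeneous _ c₂ _ from h₂).mul (hthom i)
    · rw [SetLike.mem_coe, LinearMap.mem_ker, relationMap_apply]
      simp [add_mul, Finset.sum_add_distrib, mul_assoc, ← Finset.mul_sum, hs, ht]

/-- The dimension of the degree `n` part of the ideal, from its free resolution. -/
theorem finrank_inf_span (ha : 1 ≤ a) (hb : 1 ≤ b)
    (hF : ∀ i, IsWeightedHomogeneous ![(a : ℤ), (b : ℤ)] (F i) ((d i : ℤ)))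
    (hs : ∑ i, s i * F i = 0) (ht : ∑ i, t i * F i = 0)
    (hshom : ∀ i, IsWeightedHomogeneous ![(a : ℤ), (b : ℤ)] (s i) ((α : ℤ) - (d i : ℤ)))
    (hthom : ∀ i, IsWeightedHomogeneous ![(a : ℤ), (b : ℤ)] (t i) ((β : ℤ) - (d i : ℤ)))
    (hgen : ∀ u : Fin 3 → MvPolynomial (Fin 2) k, (∑ i, u i * F i = 0) →
      ∃ c₁ c₂ : MvPolynomial (Fin 2) k, u = c₁ • s + c₂ • t)
    (hindep : ∀ c₁ c₂ : MvPolynomial (Fin 2) k, c₁ • s + c₂ • t = 0 → c₁ = 0 ∧ c₂ = 0) (n : ℤ) :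
    Module.finrank k (weightedHomogeneousSubmodule k ![(a : ℤ), (b : ℤ)] n ⊓
        (Ideal.span {F 0, F 1, F 2}).restrictScalars k :
        Submodule k (MvPolynomial (Fin 2) k)) +
      (Module.finrank k (weightedHomogeneousSubmodule k ![(a : ℤ), (b : ℤ)] (n - α)) +
        Module.finrank k (weightedHomogeneousSubmodule k ![(a : ℤ), (b : ℤ)] (n - β))) =
      ∑ i, Module.finrank k (weightedHomogeneousSubmodule k ![(a : ℤ), (b : ℤ)] (n - d i)) := by
  have hfin (m : ℤ) := finiteDimensional_weightedHomogeneousSubmodule (k := k) ha hb m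
  have hfinpi := (Submodule.piEquivPi fun i =>
      weightedHomogeneousSubmodule k ![(a : ℤ), (b : ℤ)] (n - d i)).symm.finiteDimensional
  have hinj : Function.Injective (syzygyMap s t) :=
    (injective_iff_map_eq_zero _).mpr fun c hc => by
      rw [syzygyMap_apply] at hc
      exact Prod.ext (hindep _ _ hc).1 (hindep _ _ hc).2
  have h := finrank_map_add_finrank_inf_ker (relationMap F) (Submodule.pi Set.univ fun i =>
      weightedHomogeneousSubmodule k ![(a : ℤ), (b : ℤ)] (n - d i))
  rwa [map_relationMap_eq hF, pi_inf_ker_relationMap_eq hs ht hshom hthom hgen,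
    ← (Submodule.equivMapOfInjective _ hinj _).finrank_eq, (Submodule.piEquivPi _).finrank_eq,
    (Submodule.prodEquivProd _ _).finrank_eq, Module.finrank_pi_fintype, Module.finrank_prod] at h

end Resolution

theorem exists_sum_weightedHomogeneousComponent_eq (a b : ℕ) (f : MvPolynomial (Fin 2) k) :
    ∃ N : ℕ, ∀ M, N ≤ M →
      ∑ n : Fin M, weightedHomogeneousComponent ![(a : ℤ), (b : ℤ)] (n : ℕ) f = f := by
  refine ⟨f.support.sup fun e => a * e 0 + b * e 1 + 1, fun M hM => ?_⟩
  ext e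
  rw [coeff_sum]
  simp only [coeff_weightedHomogeneousComponent, weight_fin_two, Nat.cast_inj]
  by_cases he : e ∈ f.support
  · have hlt : a * e 0 + b * e 1 < M :=
      (Finset.le_sup (f := fun e : Fin 2 →₀ ℕ => a * e 0 + b * e 1 + 1) he).trans hM
    rw [Finset.sum_eq_single ⟨_, hlt⟩] <;> simp +contextual [Fin.ext_iff, eq_comm]
  · simp [notMem_support_iff.mp he]

theorem weightedHomogeneousComponent_sum {σ M ι : Type*} [AddCommMonoid M] [Fintype ι]
    {w : σ → M} {m : ι → M} (hm : Function.Injective m) {u : ι → MvPolynomial σ k}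
    (hu : ∀ i, u i ∈ weightedHomogeneousSubmodule k w (m i)) (j : ι) :
    weightedHomogeneousComponent w (m j) (∑ i, u i) = u j := by
  classical
  rw [map_sum, Finset.sum_eq_single j]
  · rw [weightedHomogeneousComponent_of_mem (hu j), if_pos rfl]
  · intro i _ hij
    rw [weightedHomogeneousComponent_of_mem (hu i), if_neg (fun h => hij (hm h.symm))]
  · simp

/-- A finite-dimensional quotient by a homogeneous ideal is the sum of its graded pieces in
bounded degrees, and the graded pieces in large degrees vanish. -/
theorem exists_finrank_quotient_eq_sum {a b : ℕ} (ha : 1 ≤ a) (hb : 1 ≤ b)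
    {I : Ideal (MvPolynomial (Fin 2) k)} [FiniteDimensional k (MvPolynomial (Fin 2) k ⧸ I)]
    (hI : ∀ f ∈ I, ∀ n, weightedHomogeneousComponent ![(a : ℤ), (b : ℤ)] n f ∈ I) :
    ∃ M : ℕ, (∀ n : ℕ, M ≤ n →
        weightedHomogeneousSubmodule k ![(a : ℤ), (b : ℤ)] n ≤ I.restrictScalars k) ∧
      Module.finrank k (MvPolynomial (Fin 2) k ⧸ I) + ∑ n ∈ Finset.range M,
        Module.finrank k (weightedHomogeneousSubmodule k ![(a : ℤ), (b : ℤ)] n ⊓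
          I.restrictScalars k : Submodule k (MvPolynomial (Fin 2) k)) =
      ∑ n ∈ Finset.range M,
        Module.finrank k (weightedHomogeneousSubmodule k ![(a : ℤ), (b : ℤ)] n) := by
  have hfin (m : ℤ) := finiteDimensional_weightedHomogeneousSubmodule (k := k) ha hb m
  let W (n : ℕ) := weightedHomogeneousSubmodule k ![(a : ℤ), (b : ℤ)] n
  let Φ (M : ℕ) : (Fin M → MvPolynomial (Fin 2) k) →ₗ[k] MvPolynomial (Fin 2) k ⧸ I :=
    (Ideal.Quotient.mkₐ k I).toLinearMap ∘ₗ ∑ i, LinearMap.proj i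
  have hΦ (M : ℕ) (u : Fin M → MvPolynomial (Fin 2) k) :
      Φ M u = Ideal.Quotient.mk I (∑ i, u i) := by
    simp [Φ]
  obtain ⟨M, hM⟩ : ∃ M, (Submodule.pi Set.univ fun i : Fin M => W i).map (Φ M) = ⊤ := by
    obtain ⟨T, hT⟩ := Module.finite_def.mp
      (inferInstance : FiniteDimensional k (MvPolynomial (Fin 2) k ⧸ I))
    choose g hg using Ideal.Quotient.mk_surjective (I := I)
    choose N hN using exists_sum_weightedHomogeneousComponent_eq (k := k) a b
    refine ⟨T.sup fun x => N (g x), ?_⟩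
    rw [← top_le_iff, ← hT, Submodule.span_le]
    intro x hx
    refine ⟨fun n => weightedHomogeneousComponent ![(a : ℤ), (b : ℤ)] (n : ℕ) (g x),
      fun n _ => weightedHomogeneousComponent_mem _ _ _, ?_⟩
    rw [hΦ, hN (g x) _ (Finset.le_sup (f := fun x => N (g x)) hx), hg]
  have hinj : Function.Injective fun i : Fin M => ((i : ℕ) : ℤ) := fun i j h => by
    simpa [Fin.ext_iff] using h
  have hker : (Submodule.pi Set.univ fun i : Fin M => W i) ⊓ LinearMap.ker (Φ M) =
      Submodule.pi Set.univ fun i : Fin M => W i ⊓ I.restrictScalars k := by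
    ext u
    simp only [Submodule.mem_inf, Submodule.mem_pi, Set.mem_univ, true_imp_iff, LinearMap.mem_ker,
      hΦ, Ideal.Quotient.eq_zero_iff_mem, Submodule.restrictScalars_mem, forall_and]
    refine and_congr_right fun hu => ⟨fun h i => ?_, fun h => Submodule.sum_mem _ fun i _ => h i⟩
    rw [← weightedHomogeneousComponent_sum hinj hu i]
    exact hI _ h _
  refine ⟨M, fun n hn f hf => ?_, ?_⟩
  · obtain ⟨u, hu, huf⟩ : Ideal.Quotient.mk I f ∈
        (Submodule.pi Set.univ fun i : Fin M => W i).map (Φ M) := hM ▸ Submodule.mem_top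
    rw [hΦ, Ideal.Quotient.eq] at huf
    have h := hI _ huf n
    rw [map_sub, map_sum, weightedHomogeneousComponent_eq_self hf, Finset.sum_eq_zero, zero_sub,
      neg_mem_iff] at h
    · exact h
    · intro i _
      rw [weightedHomogeneousComponent_of_mem (hu i trivial), if_neg]
      have := i.2
      omega
  · have hfinpi := (Submodule.piEquivPi fun i : Fin M => W i).symm.finiteDimensional
    have h := finrank_map_add_finrank_inf_ker (Φ M) (Submodule.pi Set.univ fun i : Fin M => W i)
    rw [hker, hM, finrank_top, (Submodule.piEquivPi _).finrank_eq,
      (Submodule.piEquivPi _).finrank_eq, Module.finrank_pi_fintype,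
      Module.finrank_pi_fintype] at h
    rwa [Finset.sum_range, Finset.sum_range]

end Weighted

theorem finiteDimensional_quotient_of_coprime {k : Type*} [Field k]
    {F : Fin 3 → MvPolynomial (Fin 2) k} (hFne : F 0 ≠ 0)
    (hcop : ∀ c : MvPolynomial (Fin 2) k, c ∣ F 0 → c ∣ F 1 → c ∣ F 2 → IsUnit c) :
    FiniteDimensional k (MvPolynomial (Fin 2) k ⧸ Ideal.span {F 0, F 1, F 2}) := by
  have hsub {i : Fin 3} : F i ∈ Ideal.span {F 0, F 1, F 2} :=
    Ideal.subset_span (by fin_cases i <;> simp)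
  refine (Module.finite_iff_krullDimLE_zero k _).mpr
    (krullDimLE_zero_quotient_of_no_common_prime (by simp) (fun h => hFne ?_) fun p hp hle => ?_)
  · simpa [h] using hsub (i := 0)
  · exact hp.not_isUnit (hcop p (Ideal.mem_span_singleton.mp (hle hsub))
      (Ideal.mem_span_singleton.mp (hle hsub)) (Ideal.mem_span_singleton.mp (hle hsub)))

/-- Let `R = k[U,V]` be graded by `deg U = a`, `deg V = b`, and let `F₁, F₂, F₃` be
homogeneous, coprime, of degrees `d₁, d₂, d₃`, with `I = (F₁,F₂,F₃)` and
`Syz_R(F₁,F₂,F₃) ≅ R(-α) ⊕ R(-β)` (i.e. the syzygy module has a homogeneous basis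
`s, t` of total degrees `α, β`).  Then
`dim_k R/I = (Q(d₁,d₂,d₃) + (α-β)²)/(4ab)` with `Q(r,s,t) = 2rs+2rt+2st-r²-s²-t²`. -/
theorem stmt4 (k : Type*) [Field k] [IsAlgClosed k] (a b : ℕ) (ha : 1 ≤ a) (hb : 1 ≤ b)
    (F : Fin 3 → MvPolynomial (Fin 2) k) (d : Fin 3 → ℕ)
    (hF : ∀ i, IsWeightedHomogeneous ![(a : ℤ), (b : ℤ)] (F i) ((d i : ℤ)))
    (hFne : ∀ i, F i ≠ 0)
    (hcop : ∀ c : MvPolynomial (Fin 2) k, c ∣ F 0 → c ∣ F 1 → c ∣ F 2 → IsUnit c)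
    (α β : ℕ) (s t : Fin 3 → MvPolynomial (Fin 2) k)
    (hs : ∑ i, s i * F i = 0) (ht : ∑ i, t i * F i = 0)
    (hshom : ∀ i, IsWeightedHomogeneous ![(a : ℤ), (b : ℤ)] (s i) ((α : ℤ) - (d i : ℤ)))
    (hthom : ∀ i, IsWeightedHomogeneous ![(a : ℤ), (b : ℤ)] (t i) ((β : ℤ) - (d i : ℤ)))
    (hgen : ∀ u : Fin 3 → MvPolynomial (Fin 2) k, (∑ i, u i * F i = 0) →
      ∃ c₁ c₂ : MvPolynomial (Fin 2) k, u = c₁ • s + c₂ • t)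
    (hindep : ∀ c₁ c₂ : MvPolynomial (Fin 2) k, c₁ • s + c₂ • t = 0 → c₁ = 0 ∧ c₂ = 0) :
    (Module.finrank k (MvPolynomial (Fin 2) k ⧸ Ideal.span {F 0, F 1, F 2}) : ℚ) =
      ((2 * (d 0 : ℚ) * (d 1 : ℚ) + 2 * (d 0 : ℚ) * (d 2 : ℚ) + 2 * (d 1 : ℚ) * (d 2 : ℚ)
          - (d 0 : ℚ) ^ 2 - (d 1 : ℚ) ^ 2 - (d 2 : ℚ) ^ 2) + ((α : ℚ) - (β : ℚ)) ^ 2) /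
        (4 * (a : ℚ) * (b : ℚ)) := by
  let W : ℤ → Submodule k (MvPolynomial (Fin 2) k) :=
    weightedHomogeneousSubmodule k ![(a : ℤ), (b : ℤ)]
  have := finiteDimensional_quotient_of_coprime (hFne 0) hcop
  have hhom : ∀ f ∈ Ideal.span {F 0, F 1, F 2}, ∀ n,
      weightedHomogeneousComponent ![(a : ℤ), (b : ℤ)] n f ∈ Ideal.span {F 0, F 1, F 2} := by
    intro f hf n
    obtain ⟨u, rfl⟩ := mem_span_triple_iff.mp hf
    refine mem_span_triple_iff.mpr
      ⟨fun i => weightedHomogeneousComponent ![(a : ℤ), (b : ℤ)] (n - d i) (u i), ?_⟩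
    rw [map_sum]
    exact Finset.sum_congr rfl fun i _ =>
      (weightedHomogeneousComponent_mul_of_right (hF i) _ _).symm
  obtain ⟨M, hle, hsum⟩ := exists_finrank_quotient_eq_sum ha hb hhom
  have hinf := finrank_inf_span ha hb hF hs ht hshom hthom hgen hindep
  simp only [Fin.sum_univ_three] at hinf
  have key := sum_shifts_eq (a := a) (b := b) (p := fun n => (Module.finrank k (W n) : ℤ))
    (fun n hn => by
      have hbot : W n = ⊥ := weightedHomogeneousSubmodule_eq_bot_of_neg a b hn
      rw [hbot, finrank_bot, Nat.cast_zero])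
    (hilbertSeries_eq ha hb) (d 0) (d 1) (d 2) α β M (fun n hn => by
      have h := hinf n
      rw [inf_eq_left.mpr (hle n hn)] at h
      zify at h
      linarith)
  have hdim : (Module.finrank k (MvPolynomial (Fin 2) k ⧸ Ideal.span {F 0, F 1, F 2}) : ℤ) =
      ∑ n ∈ Finset.range M, ((Module.finrank k (W n) : ℤ) - Module.finrank k (W (n - d 0)) -
        Module.finrank k (W (n - d 1)) - Module.finrank k (W (n - d 2)) +
        Module.finrank k (W (n - α)) + Module.finrank k (W (n - β))) := by
    zify at hsum
    rw [← eq_sub_iff_add_eq, ← Finset.sum_sub_distrib] at hsum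
    rw [hsum]
    refine Finset.sum_congr rfl fun n _ => ?_
    have h := hinf n
    zify at h
    linarith
  rw [← hdim] at key
  have hab : (4 * (a : ℚ) * b) ≠ 0 := by positivity
  rw [eq_div_iff hab, mul_comm]
  exact_mod_cast key
end
end

section
/- Let sg(F₁,F₂,F₃) := d₁+d₂+d₃ - 2·m(F₁,F₂,F₃), where m is the minimal degree of a nontrivial syzygy. For homogeneous nonzero F and homogeneous F₁,F₂,F₃ in R = k[U,V]: (i) sg(FF₁,FF₂,FF₃) = deg F + sg(F₁,F₂,F₃); (ii) if F and F₃ are coprime then sg(FF₁,FF₂,F₃) = sg(F₁,F₂,F₃); (iii) |sg(FF₁,F₂,F₃) - sg(F₁,F₂,F₃)| ≤ deg F. -/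
open MvPolynomial

noncomputable section

/-- The set of total degrees of nontrivial homogeneous syzygies of `F₁, F₂, F₃`,
where `F i` is weighted-homogeneous of degree `d i` for the weights `w`. -/
def syzDegSet {k : Type*} [Field k] (w : Fin 2 → ℤ) (d : Fin 3 → ℤ)
    (F : Fin 3 → MvPolynomial (Fin 2) k) : Set ℤ :=
  {m | ∃ s : Fin 3 → MvPolynomial (Fin 2) k,
      s ≠ 0 ∧ ∑ i, s i * F i = 0 ∧ ∀ i, IsWeightedHomogeneous w (s i) (m - d i)}

/-- The syzygy gap `sg(F₁,F₂,F₃) = d₁ + d₂ + d₃ - 2·m(F₁,F₂,F₃)`, where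
`m(F₁,F₂,F₃)` is the minimal total degree of a nontrivial syzygy. -/
noncomputable def sg {k : Type*} [Field k] (w : Fin 2 → ℤ) (d : Fin 3 → ℤ)
    (F : Fin 3 → MvPolynomial (Fin 2) k) : ℤ :=
  d 0 + d 1 + d 2 - 2 * sInf (syzDegSet w d F)

section

attribute [local instance] MvPolynomial.weightedGradedAlgebra

theorem MvPolynomial.IsWeightedHomogeneous.of_mul_left {σ R M : Type*} [CommRing R] [IsDomain R]
    [AddCommGroup M] {w : σ → M} {p q : MvPolynomial σ R} {m n : M}
    (hp : IsWeightedHomogeneous w p m) (hp0 : p ≠ 0) (hpq : IsWeightedHomogeneous w (p * q) n) :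
    IsWeightedHomogeneous w q (n - m) := by
  classical
  have hcomp := DirectSum.coe_decompose_mul_add_of_left_mem (weightedHomogeneousSubmodule R w)
    (j := n - m) (b := q) ((mem_weightedHomogeneousSubmodule R w m p).2 hp)
  rw [add_sub_cancel, DirectSum.decompose_of_mem_same _
    ((mem_weightedHomogeneousSubmodule R w n _).2 hpq)] at hcomp
  rw [mul_left_cancel₀ hp0 hcomp]
  exact (DirectSum.decompose (weightedHomogeneousSubmodule R w) q (n - m)).2

end

theorem MvPolynomial.IsWeightedHomogeneous.degree_nonneg {σ R : Type*} [CommSemiring R]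
    {w : σ → ℤ} (hw : 0 ≤ w) {p : MvPolynomial σ R} {n : ℤ}
    (hp : IsWeightedHomogeneous w p n) (hp0 : p ≠ 0) : 0 ≤ n := by
  obtain ⟨c, hc⟩ := ne_zero_iff.1 hp0
  rw [← hp hc, Finsupp.weight_apply]
  exact Finset.sum_nonneg fun i _ => nsmul_nonneg (hw i) _

theorem Int.csInf_eq_add_of_mem_iff {S T : Set ℤ} {e : ℤ} (hne : S.Nonempty) (hbdd : BddBelow S)
    (h : ∀ m, m ∈ T ↔ m - e ∈ S) : sInf T = sInf S + e := by
  refine IsLeast.csInf_eq ⟨(h _).2 ?_, fun m hm => ?_⟩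
  · simpa using Int.csInf_mem hne hbdd
  · linarith [csInf_le hbdd ((h m).1 hm)]

section SyzygyDegrees

variable {k : Type*} [Field k] {w : Fin 2 → ℤ} {d : Fin 3 → ℤ} {F : Fin 3 → MvPolynomial (Fin 2) k}
  {G : MvPolynomial (Fin 2) k} {e : ℤ}

theorem bddBelow_syzDegSet (hw : 0 ≤ w) (hd : 0 ≤ d) : BddBelow (syzDegSet w d F) := by
  refine ⟨0, ?_⟩
  rintro m ⟨s, hs, -, hhom⟩
  obtain ⟨i, hi⟩ := Function.ne_iff.1 hs
  have hdi : 0 ≤ d i := hd i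
  linarith [(hhom i).degree_nonneg hw hi]

theorem syzDegSet_nonempty (hF : ∀ i, IsWeightedHomogeneous w (F i) (d i)) (hF0 : F 0 ≠ 0) :
    (syzDegSet w d F).Nonempty := by
  refine ⟨d 0 + d 1, ![F 1, -F 0, 0], fun h => hF0 ?_, ?_, fun i => ?_⟩
  · simpa using congrFun h 1
  · simp only [Fin.sum_univ_three, Matrix.cons_val]
    ring
  · fin_cases i
    · simpa using hF 1
    · simpa using (hF 0).neg
    · exact isWeightedHomogeneous_zero _ _ _

theorem mem_syzDegSet_mul_iff (hG : G ≠ 0) (m : ℤ) :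
    m ∈ syzDegSet w (fun i => d i + e) (fun i => G * F i) ↔ m - e ∈ syzDegSet w d F := by
  refine exists_congr fun s => and_congr_right' (and_congr ?_ (forall_congr' fun i => ?_))
  · simp only [mul_left_comm _ G, ← Finset.mul_sum, mul_eq_zero, hG, false_or]
  · rw [sub_sub, add_comm e]

theorem mem_syzDegSet_mul_mul_iff (hG : IsWeightedHomogeneous w G e) (hG0 : G ≠ 0)
    (hcop : IsRelPrime G (F 2)) (m : ℤ) :
    m ∈ syzDegSet w ![d 0 + e, d 1 + e, d 2] ![G * F 0, G * F 1, F 2] ↔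
      m - e ∈ syzDegSet w d F := by
  constructor
  · rintro ⟨s, hs, hsum, hhom⟩
    simp only [Fin.sum_univ_three, Matrix.cons_val] at hsum
    obtain ⟨t, ht⟩ : G ∣ s 2 := hcop.dvd_of_dvd_mul_right
      ⟨-(s 0 * F 0 + s 1 * F 1), by linear_combination hsum⟩
    have h0 := hhom 0
    have h1 := hhom 1
    have h2 := hhom 2
    simp only [Matrix.cons_val] at h0 h1 h2
    refine ⟨![s 0, s 1, t], fun h => hs ?_, ?_, fun i => ?_⟩
    · have ht0 : t = 0 := by simpa using congrFun h 2
      funext i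
      fin_cases i
      · simpa using congrFun h 0
      · simpa using congrFun h 1
      · simp [ht, ht0]
    · refine (mul_eq_zero.1 ?_).resolve_left hG0
      simp only [Fin.sum_univ_three, Matrix.cons_val]
      rw [ht] at hsum
      linear_combination hsum
    · fin_cases i
      · simpa [sub_sub, add_comm] using h0
      · simpa [sub_sub, add_comm] using h1
      · rw [ht] at h2
        simpa [sub_sub, add_comm] using hG.of_mul_left hG0 h2
  · rintro ⟨s, hs, hsum, hhom⟩
    simp only [Fin.sum_univ_three] at hsum
    refine ⟨![s 0, s 1, G * s 2], fun h => hs ?_, ?_, fun i => ?_⟩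
    · funext i
      fin_cases i
      · simpa using congrFun h 0
      · simpa using congrFun h 1
      · simpa [hG0] using congrFun h 2
    · simp only [Fin.sum_univ_three, Matrix.cons_val]
      linear_combination G * hsum
    · fin_cases i
      · simpa [sub_sub, add_comm] using hhom 0
      · simpa [sub_sub, add_comm] using hhom 1
      · have h2 := hG.mul (hhom 2)
        rw [show e + (m - e - d 2) = m - d 2 by ring] at h2
        simpa using h2

theorem add_mem_syzDegSet_update (hG : IsWeightedHomogeneous w G e) (hG0 : G ≠ 0) {m : ℤ}
    (hm : m ∈ syzDegSet w d F) :
    m + e ∈ syzDegSet w (Function.update d 0 (d 0 + e)) (Function.update F 0 (G * F 0)) := by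
  obtain ⟨s, hs, hsum, hhom⟩ := hm
  simp only [Fin.sum_univ_three] at hsum
  refine ⟨![s 0, G * s 1, G * s 2], fun h => hs ?_, ?_, fun i => ?_⟩
  · funext i
    fin_cases i
    · simpa using congrFun h 0
    · simpa [hG0] using congrFun h 1
    · simpa [hG0] using congrFun h 2
  · simp only [Fin.sum_univ_three, Matrix.cons_val, Function.update_self, ne_eq, Fin.reduceEq,
      not_false_eq_true, Function.update_of_ne]
    linear_combination G * hsum
  · fin_cases i
    · simpa using hhom 0
    · have h1 := hG.mul (hhom 1)
      rw [show e + (m - d 1) = m + e - d 1 by ring] at h1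
      simpa using h1
    · have h2 := hG.mul (hhom 2)
      rw [show e + (m - d 2) = m + e - d 2 by ring] at h2
      simpa using h2

theorem syzDegSet_update_subset (hG : IsWeightedHomogeneous w G e) (hG0 : G ≠ 0) :
    syzDegSet w (Function.update d 0 (d 0 + e)) (Function.update F 0 (G * F 0)) ⊆
      syzDegSet w d F := by
  rintro m ⟨s, hs, hsum, hhom⟩
  refine ⟨![G * s 0, s 1, s 2], fun h => hs ?_, ?_, fun i => ?_⟩
  · funext i
    fin_cases i
    · simpa [hG0] using congrFun h 0
    · simpa using congrFun h 1
    · simpa using congrFun h 2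
  · simp only [Fin.sum_univ_three, Matrix.cons_val, Function.update_self, ne_eq, Fin.reduceEq,
      not_false_eq_true, Function.update_of_ne] at hsum ⊢
    linear_combination hsum
  · fin_cases i
    · have h0 := hG.mul (hhom 0)
      rw [Function.update_self, show e + (m - (d 0 + e)) = m - d 0 by ring] at h0
      simpa using h0
    · simpa using hhom 1
    · simpa using hhom 2

end SyzygyDegrees

/-- Basic properties of the syzygy gap in `R = k[U,V]` (weights `a`, `b`):
for homogeneous nonzero `G` of degree `e` and homogeneous `F₁,F₂,F₃` of degrees `d i`:
(i) `sg(GF₁,GF₂,GF₃) = deg G + sg(F₁,F₂,F₃)`;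
(ii) if `G` and `F₃` are coprime then `sg(GF₁,GF₂,F₃) = sg(F₁,F₂,F₃)`;
(iii) `|sg(GF₁,F₂,F₃) - sg(F₁,F₂,F₃)| ≤ deg G`. -/
theorem stmt5 (k : Type*) [Field k] [IsAlgClosed k] (a b : ℕ) (ha : 1 ≤ a) (hb : 1 ≤ b)
    (G : MvPolynomial (Fin 2) k) (e : ℕ)
    (hG : IsWeightedHomogeneous ![(a : ℤ), (b : ℤ)] G (e : ℤ)) (hGne : G ≠ 0)
    (F : Fin 3 → MvPolynomial (Fin 2) k) (d : Fin 3 → ℕ)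
    (hF : ∀ i, IsWeightedHomogeneous ![(a : ℤ), (b : ℤ)] (F i) ((d i : ℤ)))
    (hFne : ∀ i, F i ≠ 0) :
    sg ![(a : ℤ), (b : ℤ)] (fun i => (d i : ℤ) + (e : ℤ)) (fun i => G * F i)
        = (e : ℤ) + sg ![(a : ℤ), (b : ℤ)] (fun i => (d i : ℤ)) F ∧
      ((∀ c : MvPolynomial (Fin 2) k, c ∣ G → c ∣ F 2 → IsUnit c) →
        sg ![(a : ℤ), (b : ℤ)] ![(d 0 : ℤ) + (e : ℤ), (d 1 : ℤ) + (e : ℤ), (d 2 : ℤ)]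
            ![G * F 0, G * F 1, F 2]
          = sg ![(a : ℤ), (b : ℤ)] (fun i => (d i : ℤ)) F) ∧
      |sg ![(a : ℤ), (b : ℤ)] (Function.update (fun i => (d i : ℤ)) 0 ((d 0 : ℤ) + (e : ℤ)))
            (Function.update F 0 (G * F 0))
          - sg ![(a : ℤ), (b : ℤ)] (fun i => (d i : ℤ)) F| ≤ (e : ℤ) := by
  set w : Fin 2 → ℤ := ![(a : ℤ), (b : ℤ)] with hw_def
  have hw : 0 ≤ w := by
    intro i
    fin_cases i <;> simp [hw_def]
  have hbdd : BddBelow (syzDegSet w (fun i => (d i : ℤ)) F) :=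
    bddBelow_syzDegSet hw fun i => Int.natCast_nonneg _
  have hne : (syzDegSet w (fun i => (d i : ℤ)) F).Nonempty := syzDegSet_nonempty hF (hFne 0)
  refine ⟨?_, fun hcop => ?_, ?_⟩
  · rw [sg, sg, Int.csInf_eq_add_of_mem_iff hne hbdd (mem_syzDegSet_mul_iff hGne)]
    ring
  · have hmem := mem_syzDegSet_mul_mul_iff (d := fun i => (d i : ℤ)) hG hGne
      (fun c hcG hcF => hcop c hcG hcF : IsRelPrime G (F 2))
    rw [sg, sg, Int.csInf_eq_add_of_mem_iff hne hbdd hmem]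
    simp only [Matrix.cons_val]
    ring
  · have hsub := syzDegSet_update_subset (d := fun i => (d i : ℤ)) (F := F) hG hGne
    have hshift := add_mem_syzDegSet_update hG hGne (Int.csInf_mem hne hbdd)
    have hupper := csInf_le (hbdd.mono hsub) hshift
    have hlower := csInf_le_csInf hbdd ⟨_, hshift⟩ hsub
    simp only [sg, Function.update_self, ne_eq, Fin.reduceEq, not_false_eq_true,
      Function.update_of_ne]
    rw [abs_le]
    constructor <;> linarith
end
end

section
/- Let k be a field, d₁,d₂,d₃ ≥ 2. The Hilbert–Kunz multiplicity of k[U,V,W]/(U^{d₁}+V^{d₂}+W^{d₃}) equals (1/4)·(2d₁+2d₂+2d₃ - d₁d₂/d₃ - d₁d₃/d₂ - d₂d₃/d₁ + d₁d₂d₃·δ(1/d₁,1/d₂,1/d₃)²). In particular, if (1/d₁,1/d₂,1/d₃) fails the strict triangle inequality, this equals min{d₁,d₂,d₃}. -/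
open MvPolynomial

noncomputable section

/-- The taxicab (ℓ¹) distance from a point of `[0,∞)³` to the odd lattice
`L_odd = {u ∈ ℕ³ : u₀+u₁+u₂ odd}`. -/
def loddDist (v : Fin 3 → ℝ) : ℝ :=
  sInf {x : ℝ | ∃ u : Fin 3 → ℕ, Odd (u 0 + u 1 + u 2) ∧ x = ∑ i, |v i - (u i : ℝ)|}

/-- Han's delta function in characteristic `p`, via Monsky's characterization
`δ(t) = max_{s ∈ ℤ} p^s · E_s(t)` with `E_s(t) = max(0, 1 - dist₁(t/p^s, L_odd))`. -/
noncomputable def hanDelta (p : ℕ) (t : Fin 3 → ℝ) : ℝ :=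
  ⨆ s : ℤ, (p : ℝ) ^ s * max 0 (1 - loddDist (fun i => t i / (p : ℝ) ^ s))

/-- The defining ideal of the diagonal hypersurface `k[U,V,W]/(U^{d₁}+V^{d₂}+W^{d₃})`. -/
def diagRel (k : Type*) [Field k] (d₁ d₂ d₃ : ℕ) : Ideal (MvPolynomial (Fin 3) k) :=
  Ideal.span {X 0 ^ d₁ + X 1 ^ d₂ + X 2 ^ d₃}

/-- The Hilbert–Kunz function of the diagonal hypersurface at `q`:
`dim_k R/(U^q, V^q, W^q)`. -/
def diagHK (k : Type*) [Field k] (d₁ d₂ d₃ q : ℕ) : ℕ :=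
  Module.finrank k
    ((MvPolynomial (Fin 3) k ⧸ diagRel k d₁ d₂ d₃) ⧸
      Ideal.span {Ideal.Quotient.mk (diagRel k d₁ d₂ d₃) (X 0) ^ q,
        Ideal.Quotient.mk (diagRel k d₁ d₂ d₃) (X 1) ^ q,
        Ideal.Quotient.mk (diagRel k d₁ d₂ d₃) (X 2) ^ q})

/-- The claimed value of the Hilbert–Kunz multiplicity of the diagonal hypersurface. -/
noncomputable def hkmDiag (p d₁ d₂ d₃ : ℕ) : ℝ :=
  (1 / 4) * (2 * (d₁ : ℝ) + 2 * (d₂ : ℝ) + 2 * (d₃ : ℝ)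
    - (d₁ : ℝ) * (d₂ : ℝ) / (d₃ : ℝ) - (d₁ : ℝ) * (d₃ : ℝ) / (d₂ : ℝ)
    - (d₂ : ℝ) * (d₃ : ℝ) / (d₁ : ℝ)
    + (d₁ : ℝ) * (d₂ : ℝ) * (d₃ : ℝ) *
        hanDelta p ![1 / (d₁ : ℝ), 1 / (d₂ : ℝ), 1 / (d₃ : ℝ)] ^ 2)

section HanDelta

lemma loddDist_le (v : Fin 3 → ℝ) {u : Fin 3 → ℕ} (hu : Odd (u 0 + u 1 + u 2)) :
    loddDist v ≤ ∑ i, |v i - (u i : ℝ)| := by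
  refine csInf_le ⟨0, ?_⟩ ⟨u, hu, rfl⟩
  rintro x ⟨w, -, rfl⟩
  exact Finset.sum_nonneg fun i _ => abs_nonneg _

lemma le_loddDist {v : Fin 3 → ℝ} {B : ℝ}
    (h : ∀ u : Fin 3 → ℕ, Odd (u 0 + u 1 + u 2) → B ≤ ∑ i, |v i - (u i : ℝ)|) :
    B ≤ loddDist v := by
  refine le_csInf ⟨_, ![1, 0, 0], by simp, rfl⟩ ?_
  rintro x ⟨u, hu, rfl⟩
  exact h u hu

lemma sum_abs_div_sub {c : ℝ} (hc : 0 < c) (t : Fin 3 → ℝ) (u : Fin 3 → ℕ) :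
    c * ∑ i, |t i / c - (u i : ℝ)| = ∑ i, |t i - c * u i| := by
  rw [Finset.mul_sum]
  refine Finset.sum_congr rfl fun i _ => ?_
  rw [← abs_of_pos hc, ← abs_mul, abs_of_pos hc]
  congr 1
  field_simp

lemma hanDelta_term_le {p : ℕ} (hp : 0 < p) {t : Fin 3 → ℝ} {B : ℝ} (hB : 0 ≤ B) (s : ℤ)
    (h : ∀ u : Fin 3 → ℕ, Odd (u 0 + u 1 + u 2) →
      (p : ℝ) ^ s - ∑ i, |t i - (p : ℝ) ^ s * u i| ≤ B) :
    (p : ℝ) ^ s * max 0 (1 - loddDist (fun i => t i / (p : ℝ) ^ s)) ≤ B := by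
  have hc : (0 : ℝ) < (p : ℝ) ^ s := by positivity
  rw [← le_div_iff₀' hc]
  refine max_le (by positivity) ?_
  rw [sub_le_comm]
  refine le_loddDist fun u hu => ?_
  have h1 := h u hu
  rw [← sum_abs_div_sub hc] at h1
  rw [sub_le_comm, le_div_iff₀' hc]
  linarith

lemma hanDelta_le {p : ℕ} (hp : 0 < p) {t : Fin 3 → ℝ} {B : ℝ} (hB : 0 ≤ B)
    (h : ∀ (s : ℤ) (u : Fin 3 → ℕ), Odd (u 0 + u 1 + u 2) →
      (p : ℝ) ^ s - ∑ i, |t i - (p : ℝ) ^ s * u i| ≤ B) :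
    hanDelta p t ≤ B :=
  ciSup_le fun s => hanDelta_term_le hp hB s (h s)

lemma bddAbove_hanDelta {p : ℕ} (hp : 0 < p) (t : Fin 3 → ℝ) :
    BddAbove (Set.range fun s : ℤ =>
      (p : ℝ) ^ s * max 0 (1 - loddDist (fun i => t i / (p : ℝ) ^ s))) := by
  refine ⟨∑ i, |t i|, ?_⟩
  rintro _ ⟨s, rfl⟩
  refine hanDelta_term_le hp (Finset.sum_nonneg fun i _ => abs_nonneg _) s fun u hu => ?_
  have hc : (0 : ℝ) < (p : ℝ) ^ s := by positivity
  have h1 : (1 : ℝ) ≤ u 0 + u 1 + u 2 := by exact_mod_cast hu.pos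
  have h2 : ∀ i, (p : ℝ) ^ s * u i - |t i| ≤ |t i - (p : ℝ) ^ s * u i| := fun i => by
    rw [abs_sub_comm]
    exact (sub_le_sub_left (le_abs_self _) _).trans (le_abs_self _)
  have h3 := Finset.sum_le_sum fun i (_ : i ∈ Finset.univ) => h2 i
  simp only [Fin.sum_univ_three] at h3 ⊢
  nlinarith

lemma hanDelta_nonneg {p : ℕ} (hp : 0 < p) (t : Fin 3 → ℝ) : 0 ≤ hanDelta p t :=
  le_ciSup_of_le (bddAbove_hanDelta hp t) 0 (by positivity)

lemma le_hanDelta {p : ℕ} (hp : 0 < p) (t : Fin 3 → ℝ) (s : ℤ) {u : Fin 3 → ℕ}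
    (hu : Odd (u 0 + u 1 + u 2)) :
    (p : ℝ) ^ s - ∑ i, |t i - (p : ℝ) ^ s * u i| ≤ hanDelta p t := by
  have hc : (0 : ℝ) < (p : ℝ) ^ s := by positivity
  refine le_ciSup_of_le (bddAbove_hanDelta hp t) s ?_
  rw [← sum_abs_div_sub hc]
  have h1 := loddDist_le (fun i => t i / (p : ℝ) ^ s) hu
  calc _ = (p : ℝ) ^ s * (1 - ∑ i, |t i / (p : ℝ) ^ s - (u i : ℝ)|) := by ring
    _ ≤ _ := by
      refine mul_le_mul_of_nonneg_left (le_max_of_le_right ?_) hc.le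
      linarith

lemma hanDelta_le_add {p : ℕ} (hp : 0 < p) (t t' : Fin 3 → ℝ) :
    hanDelta p t ≤ hanDelta p t' + ∑ i, |t i - t' i| := by
  refine hanDelta_le hp (add_nonneg (hanDelta_nonneg hp _)
    (Finset.sum_nonneg fun i _ => abs_nonneg _)) fun s u hu => ?_
  have h1 := le_hanDelta hp t' s hu
  have h2 : ∑ i, |t' i - (p : ℝ) ^ s * u i| ≤
      ∑ i, |t i - t' i| + ∑ i, |t i - (p : ℝ) ^ s * u i| := by
    rw [← Finset.sum_add_distrib]
    refine Finset.sum_le_sum fun i _ => ?_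
    rw [abs_sub_comm (t i) (t' i)]
    exact abs_sub_le _ _ _
  linarith

lemma continuous_hanDelta {p : ℕ} (hp : 0 < p) : Continuous (hanDelta p) := by
  rw [continuous_iff_continuousAt]
  intro t
  rw [ContinuousAt, tendsto_iff_dist_tendsto_zero]
  have h0 : Filter.Tendsto (fun t' : Fin 3 → ℝ => ∑ i, |t' i - t i|) (nhds t) (nhds 0) := by
    have : Continuous (fun t' : Fin 3 → ℝ => ∑ i, |t' i - t i|) := by fun_prop
    simpa using this.tendsto t
  refine squeeze_zero (fun _ => dist_nonneg) (fun t' => ?_) h0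
  rw [Real.dist_eq, abs_le]
  have h1 := hanDelta_le_add hp t t'
  have h2 := hanDelta_le_add hp t' t
  simp_rw [abs_sub_comm (t _) (t' _)] at h1
  constructor <;> linarith

lemma hanDelta_zpow_mul_le {p : ℕ} (hp : 0 < p) (e : ℤ) (t : Fin 3 → ℝ) :
    hanDelta p (fun i => (p : ℝ) ^ e * t i) ≤ (p : ℝ) ^ e * hanDelta p t := by
  have hc : (0 : ℝ) < (p : ℝ) ^ e := by positivity
  refine hanDelta_le hp (mul_nonneg hc.le (hanDelta_nonneg hp _)) fun s u hu => ?_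
  have h1 := mul_le_mul_of_nonneg_left (le_hanDelta hp t (s - e) hu) hc.le
  refine le_trans (le_of_eq ?_) h1
  have hs : (p : ℝ) ^ s = (p : ℝ) ^ e * (p : ℝ) ^ (s - e) := by
    rw [← zpow_add₀ (by positivity)]; congr 1; ring
  rw [mul_sub, Finset.mul_sum, hs]
  congr 1
  refine Finset.sum_congr rfl fun i _ => ?_
  nth_rewrite 3 [← abs_of_pos hc]
  rw [← abs_mul]
  congr 1
  ring

lemma hanDelta_zpow_mul {p : ℕ} (hp : 0 < p) (e : ℤ) (t : Fin 3 → ℝ) :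
    hanDelta p (fun i => (p : ℝ) ^ e * t i) = (p : ℝ) ^ e * hanDelta p t := by
  refine le_antisymm (hanDelta_zpow_mul_le hp e t) ?_
  have hc : (0 : ℝ) < (p : ℝ) ^ e := by positivity
  have h1 := hanDelta_zpow_mul_le hp (-e) (fun i => (p : ℝ) ^ e * t i)
  simp only [← mul_assoc, zpow_neg, inv_mul_cancel₀ hc.ne', one_mul] at h1
  rwa [le_inv_mul_iff₀ hc] at h1

lemma hanDelta_comp_perm {p : ℕ} (hp : 0 < p) (t : Fin 3 → ℝ) (σ : Equiv.Perm (Fin 3)) :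
    hanDelta p (t ∘ σ) = hanDelta p t := by
  have key : ∀ (t : Fin 3 → ℝ) (σ : Equiv.Perm (Fin 3)),
      hanDelta p (t ∘ σ) ≤ hanDelta p t := by
    intro t σ
    refine hanDelta_le hp (hanDelta_nonneg hp _) fun s u hu => ?_
    have hu' : Odd ((u ∘ σ.symm) 0 + (u ∘ σ.symm) 1 + (u ∘ σ.symm) 2) := by
      rw [← Fin.sum_univ_three] at hu ⊢
      simpa only [Function.comp_apply, Equiv.sum_comp σ.symm u] using hu
    refine le_trans (le_of_eq ?_) (le_hanDelta hp t s hu')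
    congr 1
    rw [eq_comm, ← Equiv.sum_comp σ]
    simp
  refine le_antisymm (key t σ) ?_
  simpa [Function.comp_assoc] using key (t ∘ σ) σ.symm

/-- Outside the strict triangle region, Han's delta function is the defect of the triangle
inequality. -/
lemma hanDelta_eq_of_add_le {p : ℕ} (hp : 1 < p) {a b c : ℝ} (hb : 0 ≤ b) (hc : 0 ≤ c)
    (h : b + c ≤ a) : hanDelta p ![a, b, c] = a - b - c := by
  have hp0 : 0 < p := by omega
  refine le_antisymm (hanDelta_le hp0 (by linarith) fun s u hu => ?_) ?_
  · have hq : (0 : ℝ) < (p : ℝ) ^ s := by positivity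
    simp only [Fin.sum_univ_three, Matrix.cons_val_zero, Matrix.cons_val_one, Matrix.cons_val]
    have e0 := abs_le.mp (le_refl |a - (p : ℝ) ^ s * u 0|)
    have e1 := abs_le.mp (le_refl |b - (p : ℝ) ^ s * u 1|)
    have e2 := abs_le.mp (le_refl |c - (p : ℝ) ^ s * u 2|)
    rcases le_or_gt (u 1 + u 2 + 1) (u 0) with h1 | h1
    · have h2 : (u 1 : ℝ) + u 2 + 1 ≤ u 0 := by exact_mod_cast h1
      nlinarith
    · have h1' : u 0 + 1 ≤ u 1 + u 2 := by
        rcases hu with ⟨w, hw⟩; omega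
      have h2 : (u 0 : ℝ) + 1 ≤ u 1 + u 2 := by exact_mod_cast h1'
      nlinarith
  · obtain ⟨n, hn⟩ := pow_unbounded_of_one_lt a (show (1 : ℝ) < p by exact_mod_cast hp)
    have h1 := le_hanDelta hp0 ![a, b, c] (n : ℤ) (u := ![1, 0, 0]) (by simp)
    simp only [Fin.sum_univ_three, Matrix.cons_val_zero, Matrix.cons_val_one, Matrix.cons_val,
      zpow_natCast, Nat.cast_one, Nat.cast_zero, mul_one, mul_zero, sub_zero, abs_of_nonneg hb,
      abs_of_nonneg hc] at h1
    rw [abs_of_nonpos (by linarith)] at h1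
    linarith

lemma hanDelta_swap₀₁ {p : ℕ} (hp : 0 < p) (a b c : ℝ) :
    hanDelta p ![a, b, c] = hanDelta p ![b, a, c] := by
  rw [← hanDelta_comp_perm hp ![b, a, c] (Equiv.swap 0 1)]
  congr 1
  ext i
  fin_cases i <;> simp [Equiv.swap_apply_def]

lemma hanDelta_swap₀₂ {p : ℕ} (hp : 0 < p) (a b c : ℝ) :
    hanDelta p ![a, b, c] = hanDelta p ![c, b, a] := by
  rw [← hanDelta_comp_perm hp ![c, b, a] (Equiv.swap 0 2)]
  congr 1
  ext i
  fin_cases i <;> simp [Equiv.swap_apply_def]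

end HanDelta

namespace Polynomial

variable {k : Type*} [Field k]

lemma isCoprime_X_X_add_one : IsCoprime (X : k[X]) (X + 1) := ⟨-1, 1, by ring⟩

lemma pow_pred_dvd_wronskian {f P : k[X]} {a : ℕ} (h : f ^ a ∣ P) (Q : k[X]) :
    f ^ (a - 1) ∣ wronskian P Q := by
  rw [wronskian]
  refine dvd_sub (((pow_dvd_pow f (Nat.sub_le a 1)).trans h).mul_right _) ?_
  exact (pow_sub_one_dvd_derivative_of_pow_dvd h).mul_right _

/-- Mason's argument: a syzygy of `X ^ a`, `1`, `(X + 1) ^ c` with gap at least `2` and coprime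
terms consists of polynomials with vanishing derivative. -/
lemma derivative_eq_zero_of_two_le_gap {P Q R : k[X]} (hsum : P + Q + R = 0)
    (hcop : IsCoprime P Q) {m a b c : ℕ} (hP : P.natDegree ≤ m) (ha : X ^ a ∣ P)
    (hb : Q.natDegree + b ≤ m) (hc : (X + 1) ^ c ∣ R) (hgap : 2 * m + 2 ≤ a + b + c) :
    derivative P = 0 ∧ derivative Q = 0 := by
  rw [← hcop.wronskian_eq_zero_iff]
  by_contra hW
  have h1 : X ^ (a - 1) ∣ wronskian P Q := pow_pred_dvd_wronskian ha Q
  have h2 : (X + 1) ^ (c - 1) ∣ wronskian P Q := by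
    rw [wronskian_eq_of_sum_zero hsum, wronskian_eq_of_sum_zero
      (by rw [← hsum]; ring : Q + R + P = 0)]
    exact pow_pred_dvd_wronskian hc P
  have h3 := natDegree_le_of_dvd (isCoprime_X_X_add_one.pow.mul_dvd h1 h2) hW
  have h4 := natDegree_wronskian_lt_add hW
  have h5 : (X ^ (a - 1) * (X + 1) ^ (c - 1) : k[X]).natDegree = (a - 1) + (c - 1) := by
    have : (X + 1 : k[X]) = X + C 1 := by simp
    rw [this, natDegree_mul (pow_ne_zero _ X_ne_zero) (pow_ne_zero _ (X_add_C_ne_zero 1)),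
      natDegree_X_pow, natDegree_pow, natDegree_X_add_C, mul_one]
  omega

lemma hanDelta_le_add_of_natCast {p : ℕ} (hp : 0 < p) {a b c a' b' c' : ℕ} :
    hanDelta p ![(a : ℝ), b, c] ≤ hanDelta p ![(a' : ℝ), b', c'] +
      (|(a : ℝ) - a'| + |(b : ℝ) - b'| + |(c : ℝ) - c'|) := by
  simpa [Fin.sum_univ_three] using hanDelta_le_add hp ![(a : ℝ), b, c] ![(a' : ℝ), b', c']

lemma X_sub_C_pow_dvd_of_mul {r s : k} {n : ℕ} {P : k[X]} (hrs : r ≠ s)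
    (h : (X - C s) ^ n ∣ (X - C r) * P) : (X - C s) ^ n ∣ P :=
  IsCoprime.dvd_of_dvd_mul_left
    ((isCoprime_X_sub_C_of_isUnit_sub (sub_ne_zero.mpr hrs.symm).isUnit).pow_left) h

lemma X_sub_C_pow_pred_dvd_of_mul {s : k} {n : ℕ} {P : k[X]}
    (h : (X - C s) ^ n ∣ (X - C s) * P) : (X - C s) ^ (n - 1) ∣ P := by
  cases n with
  | zero => simp
  | succ n =>
    rw [pow_succ'] at h
    exact (mul_dvd_mul_iff_left (X_sub_C_ne_zero s)).mp h

theorem gap_le_hanDelta [IsAlgClosed k] {p : ℕ} (hp : p.Prime) [CharP k p] (m : ℕ) :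
    ∀ {P Q R : k[X]}, P ≠ 0 → Q ≠ 0 → R ≠ 0 → P + Q + R = 0 → P.natDegree ≤ m →
      R.natDegree ≤ m → ∀ {a b c : ℕ}, (X - C 0) ^ a ∣ P → Q.natDegree + b ≤ m →
      (X - C (-1)) ^ c ∣ R → (a + b + c : ℝ) - 2 * m ≤ hanDelta p ![(a : ℝ), b, c] := by
  have hp0 : 0 < p := hp.pos
  induction m using Nat.strong_induction_on with
  | _ m ih =>
  intro P Q R hP0 hQ0 hR0 hsum hPm hRm a b c ha hb hc
  by_cases hcop : IsCoprime P Q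
  swap
  · -- remove a common root
    rw [isCoprime_iff_aeval_ne_zero_of_isAlgClosed k k] at hcop
    push Not at hcop
    obtain ⟨r, hr1, hr2⟩ := hcop
    rw [coe_aeval_eq_eval] at hr1 hr2
    obtain ⟨P, rfl⟩ := dvd_iff_isRoot.mpr hr1
    obtain ⟨Q, rfl⟩ := dvd_iff_isRoot.mpr hr2
    obtain ⟨R, rfl⟩ : (X - C r) ∣ R :=
      ⟨-(P + Q), by linear_combination hsum⟩
    rw [← mul_add, ← mul_add] at hsum
    have hsum' := (mul_eq_zero.mp hsum).resolve_left (X_sub_C_ne_zero r)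
    have hP0' := right_ne_zero_of_mul hP0
    have hQ0' := right_ne_zero_of_mul hQ0
    have hR0' := right_ne_zero_of_mul hR0
    rw [natDegree_mul (X_sub_C_ne_zero r) (by assumption), natDegree_X_sub_C] at hPm hRm hb
    obtain ⟨m, rfl⟩ : ∃ m', m = m' + 1 := ⟨m - 1, by omega⟩
    have key := fun {a b c : ℕ} => ih m (by omega) hP0' hQ0' hR0' hsum' (by omega) (by omega)
      (a := a) (b := b) (c := c)
    by_cases h0 : r = 0
    · subst h0
      have h1 := key (X_sub_C_pow_pred_dvd_of_mul ha) (by omega : Q.natDegree + b ≤ m)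
        (X_sub_C_pow_dvd_of_mul (by simp) hc)
      have h2 := hanDelta_le_add_of_natCast hp0 (a := a - 1) (b := b) (c := c) (a' := a) (b' := b)
        (c' := c)
      have h3 : (a : ℝ) ≤ (a - 1 : ℕ) + 1 := by norm_cast; omega
      have h4 : |((a - 1 : ℕ) : ℝ) - a| ≤ 1 := by
        have : ((a - 1 : ℕ) : ℝ) ≤ a := by norm_cast; omega
        rw [abs_le]; constructor <;> linarith
      simp only [sub_self, abs_zero] at h2
      push_cast
      linarith
    by_cases h1 : r = -1
    · subst h1
      have h1 := key (X_sub_C_pow_dvd_of_mul (by simp) ha) (by omega : Q.natDegree + b ≤ m)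
        (X_sub_C_pow_pred_dvd_of_mul hc)
      have h2 := hanDelta_le_add_of_natCast hp0 (a := a) (b := b) (c := c - 1) (a' := a) (b' := b)
        (c' := c)
      have h3 : (c : ℝ) ≤ (c - 1 : ℕ) + 1 := by norm_cast; omega
      have h4 : |((c - 1 : ℕ) : ℝ) - c| ≤ 1 := by
        have : ((c - 1 : ℕ) : ℝ) ≤ c := by norm_cast; omega
        rw [abs_le]; constructor <;> linarith
      simp only [sub_self, abs_zero] at h2
      push_cast
      linarith
    · have h2 := key (X_sub_C_pow_dvd_of_mul h0 ha) (by omega : Q.natDegree + b ≤ m)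
        (X_sub_C_pow_dvd_of_mul h1 hc)
      push_cast
      linarith
  by_cases hdeg : P.natDegree < m ∧ Q.natDegree < m ∧ R.natDegree < m
  · -- remove a common factor at infinity
    obtain ⟨m, rfl⟩ : ∃ m', m = m' + 1 := ⟨m - 1, by omega⟩
    have h1 := ih m (by omega) hP0 hQ0 hR0 hsum (by omega) (by omega) ha
      (by omega : Q.natDegree + (b - 1) ≤ m) hc
    have h2 := hanDelta_le_add_of_natCast hp0 (a := a) (b := b - 1) (c := c) (a' := a) (b' := b)
      (c' := c)
    have h3 : (b : ℝ) ≤ (b - 1 : ℕ) + 1 := by norm_cast; omega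
    have h4 : |((b - 1 : ℕ) : ℝ) - b| ≤ 1 := by
      have : ((b - 1 : ℕ) : ℝ) ≤ b := by norm_cast; omega
      rw [abs_le]; constructor <;> linarith
    simp only [sub_self, abs_zero] at h2
    push_cast
    linarith
  -- pass to the exact orders of vanishing
  set a' := P.rootMultiplicity 0
  set c' := R.rootMultiplicity (-1)
  set b' := m - Q.natDegree
  have haa : a ≤ a' := (le_rootMultiplicity_iff hP0).mpr ha
  have hcc : c ≤ c' := (le_rootMultiplicity_iff hR0).mpr hc
  have hbb : b ≤ b' := by omega
  suffices hmain : (a' + b' + c' : ℝ) - 2 * m ≤ hanDelta p ![(a' : ℝ), b', c'] by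
    have h2 := hanDelta_le_add_of_natCast hp0 (a := a') (b := b') (c := c') (a' := a) (b' := b)
      (c' := c)
    have haa' : (a : ℝ) ≤ a' := by exact_mod_cast haa
    have hbb' : (b : ℝ) ≤ b' := by exact_mod_cast hbb
    have hcc' : (c : ℝ) ≤ c' := by exact_mod_cast hcc
    rw [abs_of_nonneg (by linarith), abs_of_nonneg (by linarith),
      abs_of_nonneg (by linarith)] at h2
    linarith
  rcases le_or_gt (a' + b' + c') (2 * m) with hg | hg
  · have : ((a' + b' + c' : ℕ) : ℝ) ≤ ((2 * m : ℕ) : ℝ) := by exact_mod_cast hg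
    push_cast at this
    linarith [hanDelta_nonneg hp0 ![(a' : ℝ), b', c']]
  rcases Nat.eq_or_lt_of_le (Nat.succ_le_of_lt hg) with hg1 | hg2
  · have h1 := le_hanDelta hp0 ![(a' : ℝ), b', c'] 0 (u := ![a', b', c']) ⟨m, by simp; omega⟩
    have h2 : ((2 * m + 1 : ℕ) : ℝ) = ((a' + b' + c' : ℕ) : ℝ) := by exact_mod_cast hg1
    push_cast at h2
    simp only [Fin.sum_univ_three, Matrix.cons_val_zero, Matrix.cons_val_one, Matrix.cons_val,
      zpow_zero, one_mul, sub_self, abs_zero] at h1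
    linarith
  have haP : X ^ a' ∣ P := by simpa using pow_rootMultiplicity_dvd P 0
  have hcR : (X + 1) ^ c' ∣ R := by simpa using pow_rootMultiplicity_dvd R (-1)
  obtain ⟨dP, dQ⟩ := derivative_eq_zero_of_two_le_gap hsum hcop hPm haP
    (by omega : Q.natDegree + b' ≤ m) hcR (by omega)
  have dR : derivative R = 0 := by
    have := congrArg derivative hsum
    simpa [dP, dQ] using this
  have := Fact.mk hp
  obtain ⟨P₁, hP₁⟩ : ∃ P₁, expand k p P₁ = P := ⟨_, expand_contract p dP hp.ne_zero⟩
  obtain ⟨Q₁, hQ₁⟩ : ∃ P₁, expand k p P₁ = Q := ⟨_, expand_contract p dQ hp.ne_zero⟩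
  obtain ⟨R₁, hR₁⟩ : ∃ P₁, expand k p P₁ = R := ⟨_, expand_contract p dR hp.ne_zero⟩
  have hneg : (-1 : k) ^ p = -1 := neg_one_pow_char k p
  have eP : P.natDegree = P₁.natDegree * p := by rw [← hP₁, natDegree_expand]
  have eQ : Q.natDegree = Q₁.natDegree * p := by rw [← hQ₁, natDegree_expand]
  have eR : R.natDegree = R₁.natDegree * p := by rw [← hR₁, natDegree_expand]
  have ea : a' = p * P₁.rootMultiplicity 0 := by
    simp only [a', ← hP₁, rootMultiplicity_expand, zero_pow hp.ne_zero]
  have ec : c' = p * R₁.rootMultiplicity (-1) := by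
    simp only [c', ← hR₁, rootMultiplicity_expand, hneg]
  obtain ⟨m₁, hm₁⟩ : ∃ m₁, m = m₁ * p := by
    rcases Nat.lt_or_ge P.natDegree m with h1 | h1
    · rcases Nat.lt_or_ge Q.natDegree m with h2 | h2
      · exact ⟨R₁.natDegree, by omega⟩
      · exact ⟨Q₁.natDegree, by omega⟩
    · exact ⟨P₁.natDegree, by omega⟩
  have hQm : Q.natDegree ≤ m := by omega
  have eb : b' = p * (m₁ - Q₁.natDegree) := by
    simp only [b', eQ, hm₁, mul_comm p, Nat.sub_mul]
  have hP₁0 : P₁ ≠ 0 := fun h => hP0 (by rw [← hP₁, h, map_zero])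
  have hQ₁0 : Q₁ ≠ 0 := fun h => hQ0 (by rw [← hQ₁, h, map_zero])
  have hR₁0 : R₁ ≠ 0 := fun h => hR0 (by rw [← hR₁, h, map_zero])
  have hm0 : m₁ ≠ 0 := by
    rintro rfl
    have h1 : a' ≤ P.natDegree := by simpa using natDegree_le_of_dvd haP hP0
    have h2 : c' ≤ R.natDegree := by
      have h3 := natDegree_le_of_dvd hcR hR0
      rwa [natDegree_pow, ← C_1, natDegree_X_add_C, mul_one] at h3
    omega
  have hsum₁ : P₁ + Q₁ + R₁ = 0 := by
    apply expand_injective hp0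
    rw [map_add, map_add, hP₁, hQ₁, hR₁, hsum, map_zero]
  have hQ₁m : Q₁.natDegree ≤ m₁ := by
    rw [eQ, hm₁] at hQm; exact Nat.le_of_mul_le_mul_right hQm hp0
  have h1 := ih m₁ (by rw [hm₁]; exact lt_mul_of_one_lt_right (by omega) hp.one_lt)
    hP₁0 hQ₁0 hR₁0 hsum₁
    (by rw [eP, hm₁] at hPm; exact Nat.le_of_mul_le_mul_right hPm hp0)
    (by rw [eR, hm₁] at hRm; exact Nat.le_of_mul_le_mul_right hRm hp0)
    (pow_rootMultiplicity_dvd P₁ 0)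
    (by omega : Q₁.natDegree + (m₁ - Q₁.natDegree) ≤ m₁)
    (pow_rootMultiplicity_dvd R₁ (-1))
  have h2 := hanDelta_zpow_mul hp0 1 ![(P₁.rootMultiplicity 0 : ℝ), (m₁ - Q₁.natDegree : ℕ),
    R₁.rootMultiplicity (-1)]
  have h3 : (fun i => (p : ℝ) ^ (1 : ℤ) * ![(P₁.rootMultiplicity 0 : ℝ), (m₁ - Q₁.natDegree : ℕ),
      R₁.rootMultiplicity (-1)] i) = ![(a' : ℝ), b', c'] := by
    ext i
    fin_cases i
    · simp [ea]
    · simp only [eb]; push_cast; simp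
    · simp [ec]
  rw [h3] at h2
  rw [h2, ea, eb, ec, hm₁, zpow_one]
  have h4 := mul_le_mul_of_nonneg_left h1 (Nat.cast_nonneg (α := ℝ) p)
  push_cast at h4 ⊢
  linarith

lemma mem_degreeLT_iff {f : k[X]} {m : ℕ} : f ∈ degreeLT k m ↔ f = 0 ∨ f.natDegree < m := by
  rw [mem_degreeLT]
  rcases eq_or_ne f 0 with rfl | hf
  · simp
  · simp [hf, natDegree_lt_iff_degree_lt]

lemma mul_mem_degreeLT {f g : k[X]} {m d n : ℕ} (hf : f ∈ degreeLT k m) (hg : g.natDegree ≤ d)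
    (h : 0 < m → m + d ≤ n) : f * g ∈ degreeLT k n := by
  rcases mem_degreeLT_iff.mp hf with rfl | hf
  · simp
  · exact mem_degreeLT_iff.mpr (Or.inr (natDegree_mul_le.trans_lt (by omega)))

lemma finrank_degreeLT (n : ℕ) : Module.finrank k (degreeLT k n) = n := by
  rw [(degreeLTEquiv k n).finrank_eq, Module.finrank_fin_fun]

lemma natDegree_X_add_one_pow (n : ℕ) : ((X + 1 : k[X]) ^ n).natDegree = n := by
  rw [natDegree_pow, ← C_1, natDegree_X_add_C, mul_one]

lemma X_add_one_ne_zero : (X + 1 : k[X]) ≠ 0 := by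
  rw [← C_1]
  exact X_add_C_ne_zero 1

variable (k) in
/-- Triples of polynomials whose `i`-th entry has degree at most `n - w i`. -/
def syzDomain (w : Fin 3 → ℕ) (n : ℕ) : Submodule k (Fin 3 → k[X]) :=
  Submodule.pi Set.univ fun i => degreeLT k (n + 1 - w i)

variable (k) in
/-- The dehomogenization at `y = 1` of the map `v ↦ x ^ a * v₀ + y ^ b * v₁ + (x + y) ^ c * v₂`
on triples of binary forms. -/
def syzMap (w : Fin 3 → ℕ) : (Fin 3 → k[X]) →ₗ[k] k[X] where
  toFun v := X ^ w 0 * v 0 + v 1 + (X + 1) ^ w 2 * v 2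
  map_add' u v := by simp only [Pi.add_apply]; ring
  map_smul' r v := by simp only [Pi.smul_apply, mul_smul_comm, smul_add, RingHom.id_apply]

variable (k) in
/-- The degree `n` part of the syzygy module of `x ^ a`, `y ^ b`, `(x + y) ^ c`, dehomogenized
at `y = 1`. -/
def syz (w : Fin 3 → ℕ) (n : ℕ) : Submodule k (Fin 3 → k[X]) :=
  syzDomain k w n ⊓ LinearMap.ker (syzMap k w)

variable (k) in
/-- The degree `n` part of the ideal `(x ^ a, y ^ b, (x + y) ^ c)`, dehomogenized at `y = 1`. -/
def idealPart (w : Fin 3 → ℕ) (n : ℕ) : Submodule k k[X] :=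
  (syzDomain k w n).map (syzMap k w)

lemma syzMap_apply (w : Fin 3 → ℕ) (v : Fin 3 → k[X]) :
    syzMap k w v = X ^ w 0 * v 0 + v 1 + (X + 1) ^ w 2 * v 2 :=
  rfl

lemma mem_syzDomain {w : Fin 3 → ℕ} {n : ℕ} {v : Fin 3 → k[X]} :
    v ∈ syzDomain k w n ↔ ∀ i, v i ∈ degreeLT k (n + 1 - w i) := by
  simp [syzDomain, Submodule.mem_pi]

lemma mem_syz {w : Fin 3 → ℕ} {n : ℕ} {v : Fin 3 → k[X]} :
    v ∈ syz k w n ↔ (∀ i, v i ∈ degreeLT k (n + 1 - w i)) ∧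
      X ^ w 0 * v 0 + v 1 + (X + 1) ^ w 2 * v 2 = 0 := by
  rw [syz, Submodule.mem_inf, mem_syzDomain, LinearMap.mem_ker, syzMap_apply]

lemma mem_idealPart {w : Fin 3 → ℕ} {n : ℕ} {f : k[X]} :
    f ∈ idealPart k w n ↔ ∃ v : Fin 3 → k[X], (∀ i, v i ∈ degreeLT k (n + 1 - w i)) ∧
      X ^ w 0 * v 0 + v 1 + (X + 1) ^ w 2 * v 2 = f := by
  simp [idealPart, mem_syzDomain, syzMap_apply]

variable (k) in
/-- `syzDomain` as a product. -/
def syzDomainEquiv (w : Fin 3 → ℕ) (n : ℕ) :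
    syzDomain k w n ≃ₗ[k] ((i : Fin 3) → degreeLT k (n + 1 - w i)) where
  toFun v i := ⟨v.1 i, mem_syzDomain.mp v.2 i⟩
  map_add' _ _ := rfl
  map_smul' _ _ := rfl
  invFun f := ⟨fun i => f i, mem_syzDomain.mpr fun i => (f i).2⟩
  left_inv _ := rfl
  right_inv _ := rfl

instance (w : Fin 3 → ℕ) (n : ℕ) : Module.Finite k (syzDomain k w n) :=
  Module.Finite.equiv (syzDomainEquiv k w n).symm

instance (w : Fin 3 → ℕ) (n : ℕ) : Module.Finite k (syz k w n) :=
  Submodule.finiteDimensional_of_le inf_le_left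

lemma finrank_syzDomain (w : Fin 3 → ℕ) (n : ℕ) :
    Module.finrank k (syzDomain k w n) = (n + 1 - w 0) + (n + 1 - w 1) + (n + 1 - w 2) := by
  rw [(syzDomainEquiv k w n).finrank_eq, Module.finrank_pi_fintype, Fin.sum_univ_three]
  simp only [finrank_degreeLT]

lemma finrank_idealPart_add_finrank_syz (w : Fin 3 → ℕ) (n : ℕ) :
    Module.finrank k (idealPart k w n) + Module.finrank k (syz k w n) =
      (n + 1 - w 0) + (n + 1 - w 1) + (n + 1 - w 2) := by
  rw [← finrank_syzDomain (k := k),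
    ← LinearMap.finrank_range_add_finrank_ker ((syzMap k w).domRestrict (syzDomain k w n)),
    LinearMap.range_domRestrict, LinearMap.ker_domRestrict, idealPart, syz]
  congr 1
  rw [← Submodule.finrank_map_subtype_eq, Submodule.map_comap_subtype]

lemma idealPart_le (w : Fin 3 → ℕ) (n : ℕ) : idealPart k w n ≤ degreeLT k (n + 1) := by
  intro f hf
  obtain ⟨v, hv, rfl⟩ := mem_idealPart.mp hf
  refine add_mem (add_mem ?_ (degreeLT_mono (Nat.sub_le _ _) (hv 1))) ?_
  · rw [mul_comm]
    exact mul_mem_degreeLT (hv 0) (natDegree_X_pow _).le (by omega)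
  · rw [mul_comm]
    exact mul_mem_degreeLT (hv 2) (natDegree_X_add_one_pow _).le (by omega)

instance (w : Fin 3 → ℕ) (n : ℕ) : Module.Finite k (idealPart k w n) :=
  Submodule.finiteDimensional_of_le (idealPart_le w n)

lemma finrank_idealPart_le (w : Fin 3 → ℕ) (n : ℕ) :
    Module.finrank k (idealPart k w n) ≤ n + 1 :=
  (Submodule.finrank_mono (idealPart_le w n)).trans_eq (finrank_degreeLT _)

lemma idealPart_succ_eq {w : Fin 3 → ℕ} {n : ℕ} (h : idealPart k w n = degreeLT k (n + 1)) :
    idealPart k w (n + 1) = degreeLT k (n + 1 + 1) := by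
  refine le_antisymm (idealPart_le w _) fun f hf => ?_
  have h1 : idealPart k w n ≤ idealPart k w (n + 1) :=
    Submodule.map_mono fun v hv => mem_syzDomain.mpr fun i =>
      degreeLT_mono (by omega) (mem_syzDomain.mp hv i)
  have hdiv : f.divX ∈ degreeLT k (n + 1) := by
    rw [mem_degreeLT, degree_lt_iff_coeff_zero]
    intro m hm
    rw [coeff_divX]
    rw [mem_degreeLT, degree_lt_iff_coeff_zero] at hf
    exact hf _ (by omega)
  rw [← h] at hdiv
  obtain ⟨v, hv, hvf⟩ := mem_idealPart.mp hdiv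
  rw [← divX_mul_X_add f]
  refine add_mem (mem_idealPart.mpr ⟨fun i => v i * X, fun i => ?_, ?_⟩) (h1 ?_)
  · exact mul_mem_degreeLT (hv i) natDegree_X_le (by omega)
  · rw [← hvf]
    ring
  · rw [h, mem_degreeLT]
    exact degree_C_le.trans_lt (by exact_mod_cast Nat.succ_pos n)

variable (k) in
/-- The codimension of `idealPart`, that is, the dimension of the degree `n` part of
`k[x, y] / (x ^ a, y ^ b, (x + y) ^ c)`. -/
def coDim (w : Fin 3 → ℕ) (n : ℕ) : ℕ := n + 1 - Module.finrank k (idealPart k w n)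

lemma coDim_eq_zero_iff {w : Fin 3 → ℕ} {n : ℕ} :
    coDim k w n = 0 ↔ idealPart k w n = degreeLT k (n + 1) := by
  have h := finrank_idealPart_le (k := k) w n
  constructor
  · intro h0
    refine Submodule.eq_of_le_of_finrank_eq (idealPart_le w n) ?_
    rw [finrank_degreeLT]
    rw [coDim] at h0
    omega
  · intro h0
    rw [coDim, h0, finrank_degreeLT, Nat.sub_self]

lemma coDim_eq_zero_of_le {w : Fin 3 → ℕ} {m n : ℕ} (h : coDim k w m = 0) (hmn : m ≤ n) :
    coDim k w n = 0 := by
  induction n, hmn using Nat.le_induction with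
  | base => exact h
  | succ n _ ih => exact coDim_eq_zero_iff.mpr (idealPart_succ_eq (coDim_eq_zero_iff.mp ih))

lemma coDim_eq (w : Fin 3 → ℕ) (n : ℕ) :
    (coDim k w n : ℤ) = (n + 1) - ((n + 1 - w 0 : ℕ) : ℤ) - ((n + 1 - w 1 : ℕ) : ℤ)
      - ((n + 1 - w 2 : ℕ) : ℤ) + Module.finrank k (syz k w n) := by
  have h1 := finrank_idealPart_le (k := k) w n
  have h2 := finrank_idealPart_add_finrank_syz (k := k) w n
  rw [coDim]
  omega

lemma syz_ne_bot {w : Fin 3 → ℕ} {n : ℕ} (h : w 0 + w 1 + w 2 < 2 * n + 2) :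
    syz k w n ≠ ⊥ := by
  intro h0
  have h1 := finrank_idealPart_le (k := k) w n
  have h2 := finrank_idealPart_add_finrank_syz (k := k) w n
  rw [h0, finrank_bot] at h2
  omega

/-- Two syzygies of small total degree are proportional. -/
lemma syz_proportional {w : Fin 3 → ℕ} {m n : ℕ} {v v' : Fin 3 → k[X]} (hv : v ∈ syz k w m)
    (hv' : v' ∈ syz k w n) (h : m + n < w 0 + w 1 + w 2) (i j : Fin 3) :
    v i * v' j = v' i * v j := by
  obtain ⟨hd, hs⟩ := mem_syz.mp hv
  obtain ⟨hd', hs'⟩ := mem_syz.mp hv'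
  have hmul : ∀ {f g : k[X]} {r s : ℕ}, f ∈ degreeLT k (r + 1 - w 0) →
      g ∈ degreeLT k (s + 1 - w 1) → r + s < w 0 + w 1 + w 2 → f * g ∈ degreeLT k (w 2) := by
    intro f g r s hf hg hrs
    rcases mem_degreeLT_iff.mp hg with rfl | hg
    · simp
    · exact mul_mem_degreeLT (d := s - w 1) hf (by omega) (by omega)
  have e1 : v 0 * v' 1 - v' 0 * v 1 = (X + 1) ^ w 2 * (v' 0 * v 2 - v 0 * v' 2) := by
    linear_combination v 0 * hs' - v' 0 * hs
  have e2 : v 0 * v' 1 - v' 0 * v 1 ∈ degreeLT k (w 2) :=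
    sub_mem (hmul (hd 0) (hd' 1) h) (hmul (hd' 0) (hd 1) (by omega))
  have e3 : v 0 * v' 1 - v' 0 * v 1 = 0 := by
    by_contra h0
    have h3 := natDegree_le_of_dvd ⟨_, e1⟩ h0
    rw [natDegree_X_add_one_pow] at h3
    rcases mem_degreeLT_iff.mp e2 with h4 | h4
    · exact h0 h4
    · omega
  have e4 : v' 0 * v 2 - v 0 * v' 2 = 0 := by
    rw [e3] at e1
    exact (mul_eq_zero.mp e1.symm).resolve_left (pow_ne_zero _ X_add_one_ne_zero)
  have e5 : v 1 * v' 2 - v' 1 * v 2 = 0 := by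
    linear_combination hs * v' 2 - hs' * v 2 + X ^ w 0 * e4
  fin_cases i <;> fin_cases j <;> simp only [Fin.zero_eta, Fin.mk_one, Fin.reduceFinMk]
  · ring
  · linear_combination e3
  · linear_combination -e4
  · linear_combination -e3
  · ring
  · linear_combination e5
  · linear_combination e4
  · linear_combination -e5
  · ring

lemma mem_syz_pred {w : Fin 3 → ℕ} {n : ℕ} {v : Fin 3 → k[X]} (hv : v ∈ syz k w (n + 1))
    (hw : ∀ i, w i ≤ n + 1) (h : ∀ i, (v i).coeff (n + 1 - w i) = 0) : v ∈ syz k w n := by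
  rw [mem_syz] at hv ⊢
  refine ⟨fun i => ?_, hv.2⟩
  have h1 := hv.1 i
  rw [mem_degreeLT, degree_lt_iff_coeff_zero] at h1 ⊢
  intro m hm
  rcases Nat.eq_or_lt_of_le hm with rfl | hm
  · exact h i
  · exact h1 m (by have := hw i; omega)

lemma finrank_syz_succ_le {w : Fin 3 → ℕ} {m n : ℕ} {v₀ : Fin 3 → k[X]}
    (hv₀ : v₀ ∈ syz k w (m + 1)) (hv₀' : v₀ ∉ syz k w m) (hw : ∀ i, w i ≤ m + 1) (hmn : m ≤ n)
    (h : m + 1 + (n + 1) < w 0 + w 1 + w 2) :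
    Module.finrank k (syz k w (n + 1)) ≤ Module.finrank k (syz k w n) + 1 := by
  obtain ⟨i, hi⟩ : ∃ i, (v₀ i).coeff (m + 1 - w i) ≠ 0 := by
    by_contra! h0
    exact hv₀' (mem_syz_pred hv₀ hw h0)
  have hdeg : ∀ {r : ℕ} {v : Fin 3 → k[X]}, v ∈ syz k w r → (∀ i, w i ≤ r) →
      ∀ j, (v j).natDegree ≤ r - w j := by
    intro r v hv hr j
    rcases mem_degreeLT_iff.mp ((mem_syz.mp hv).1 j) with h1 | h1
    · simp [h1]
    · have := hr j
      omega
  let τ : syz k w (n + 1) →ₗ[k] k := lcoeff k (n + 1 - w i) ∘ₗ LinearMap.proj i ∘ₗ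
    (syz k w (n + 1)).subtype
  have hτ : ∀ v : syz k w (n + 1), v ∈ LinearMap.ker τ → (v : Fin 3 → k[X]) ∈ syz k w n := by
    rintro ⟨v, hv⟩ h0
    have h0' : (v i).coeff (n + 1 - w i) = 0 := h0
    refine mem_syz_pred hv (fun j => (hw j).trans (by omega)) fun j => ?_
    have h1 := congrArg (fun f => coeff f ((m + 1 - w i) + (n + 1 - w j)))
      (syz_proportional hv₀ hv h i j)
    have h2 : (m + 1 - w i) + (n + 1 - w j) = (n + 1 - w i) + (m + 1 - w j) := by
      have := hw i; have := hw j; omega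
    have hw' : ∀ i, w i ≤ n + 1 := fun i => (hw i).trans (by omega)
    rw [coeff_mul_add_eq_of_natDegree_le (hdeg hv₀ hw i) (hdeg hv hw' j), h2,
      coeff_mul_add_eq_of_natDegree_le (hdeg hv hw' i) (hdeg hv₀ hw j), h0', zero_mul] at h1
    exact (mul_eq_zero.mp h1).resolve_left hi
  have h3 := LinearMap.finrank_range_add_finrank_ker τ
  have h4 : Module.finrank k (LinearMap.range τ) ≤ 1 :=
    (Submodule.finrank_le _).trans_eq (Module.finrank_self k)
  have h5 : Module.finrank k (LinearMap.ker τ) ≤ Module.finrank k (syz k w n) := by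
    rw [← Submodule.finrank_map_subtype_eq]
    refine Submodule.finrank_mono ?_
    rintro _ ⟨v, hv, rfl⟩
    exact hτ v hv
  omega

lemma le_finrank_syz {w : Fin 3 → ℕ} {m n : ℕ} {v₀ : Fin 3 → k[X]}
    (hv₀ : v₀ ∈ syz k w m) (h0 : v₀ ≠ 0) :
    n + 1 - m ≤ Module.finrank k (syz k w n) := by
  obtain ⟨i, hi⟩ := Function.ne_iff.mp h0
  let μ : k[X] →ₗ[k] (Fin 3 → k[X]) := LinearMap.pi fun i => LinearMap.mulLeft k (v₀ i)
  have hμ : ∀ f i, μ f i = v₀ i * f := fun f i => rfl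
  have hinj : Function.Injective μ := by
    intro f g hfg
    have := congrFun hfg i
    rw [hμ, hμ] at this
    exact mul_left_cancel₀ hi this
  have h1 : (degreeLT k (n + 1 - m)).map μ ≤ syz k w n := by
    rintro _ ⟨f, hf, rfl⟩
    obtain ⟨hd, hs⟩ := mem_syz.mp hv₀
    refine mem_syz.mpr ⟨fun i => ?_, ?_⟩
    · rw [hμ]
      rcases mem_degreeLT_iff.mp hf with rfl | hf
      · simp
      · exact mul_mem_degreeLT (d := n - m) (hd i) (by omega) (by omega)
    · simp only [hμ]
      linear_combination f * hs
  have h2 := Submodule.finrank_mono h1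
  rwa [((degreeLT k (n + 1 - m)).equivMapOfInjective μ hinj).symm.finrank_eq,
    finrank_degreeLT] at h2

lemma eq_zero_of_dvd_of_mem_degreeLT {f g : k[X]} {m : ℕ} (hf : f ∈ degreeLT k m) (hgf : g ∣ f)
    (hg : m ≤ g.natDegree) : f = 0 := by
  by_contra h0
  have h1 := natDegree_le_of_dvd hgf h0
  rcases mem_degreeLT_iff.mp hf with h2 | h2
  · exact h0 h2
  · omega

/-- A syzygy with a vanishing entry is a Koszul relation, so it vanishes in small degree. -/
lemma syz_eq_zero_of_apply_eq_zero {w : Fin 3 → ℕ} {n : ℕ} {v : Fin 3 → k[X]}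
    (hv : v ∈ syz k w n) {i : Fin 3} (hi : v i = 0) (h : n + w i < w 0 + w 1 + w 2) : v = 0 := by
  obtain ⟨hd, hs⟩ := mem_syz.mp hv
  have hX : (X : k[X]) ^ w 0 ≠ 0 := pow_ne_zero _ X_ne_zero
  have hY : (X + 1 : k[X]) ^ w 2 ≠ 0 := pow_ne_zero _ X_add_one_ne_zero
  suffices v 0 = 0 ∧ v 1 = 0 ∧ v 2 = 0 by
    ext1 j
    fin_cases j
    exacts [this.1, this.2.1, this.2.2]
  fin_cases i <;> simp only [Fin.zero_eta, Fin.mk_one, Fin.reduceFinMk] at hi h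
  · have h1 : v 1 = 0 := by
      refine eq_zero_of_dvd_of_mem_degreeLT (hd 1) (g := (X + 1) ^ w 2) ⟨-v 2, ?_⟩ ?_
      · rw [hi] at hs
        linear_combination hs
      · rw [natDegree_X_add_one_pow]; omega
    rw [hi, h1] at hs
    simp only [mul_zero, zero_add] at hs
    exact ⟨hi, h1, (mul_eq_zero.mp hs).resolve_left hY⟩
  · have h1 : v 2 = 0 := by
      refine eq_zero_of_dvd_of_mem_degreeLT (hd 2) (g := X ^ w 0) ?_ ?_
      · refine (isCoprime_X_X_add_one.pow (m := w 0) (n := w 2)).dvd_of_dvd_mul_left ⟨-v 0, ?_⟩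
        rw [hi] at hs
        linear_combination hs
      · rw [natDegree_X_pow]; omega
    rw [hi, h1] at hs
    simp only [mul_zero, add_zero] at hs
    exact ⟨(mul_eq_zero.mp hs).resolve_left hX, hi, h1⟩
  · have h1 : v 1 = 0 := by
      refine eq_zero_of_dvd_of_mem_degreeLT (hd 1) (g := X ^ w 0) ⟨-v 0, ?_⟩ ?_
      · rw [hi] at hs
        linear_combination hs
      · rw [natDegree_X_pow]; omega
    rw [hi, h1] at hs
    simp only [mul_zero, add_zero] at hs
    exact ⟨(mul_eq_zero.mp hs).resolve_left hX, h1, hi⟩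

lemma apply_eq_zero_of_mem_syz {w : Fin 3 → ℕ} {n : ℕ} {v : Fin 3 → k[X]} (hv : v ∈ syz k w n)
    {i : Fin 3} (hi : n < w i) : v i = 0 := by
  rcases mem_degreeLT_iff.mp ((mem_syz.mp hv).1 i) with h | h
  · exact h
  · omega

lemma syz_frobenius {p : ℕ} (hp : p.Prime) [CharP k p] {w : Fin 3 → ℕ} {n : ℕ}
    {v : Fin 3 → k[X]} (hv : v ∈ syz k w n) (r : ℕ) :
    (fun i => v i ^ p ^ r) ∈ syz k (fun i => p ^ r * w i) (p ^ r * n) := by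
  have := Fact.mk hp
  obtain ⟨hd, hs⟩ := mem_syz.mp hv
  have hq : 0 < p ^ r := pow_pos hp.pos r
  refine mem_syz.mpr ⟨fun i => ?_, ?_⟩
  · rw [mem_degreeLT_iff]
    rcases mem_degreeLT_iff.mp (hd i) with h | h
    · left
      simp [h, hp.ne_zero]
    · right
      rw [natDegree_pow]
      have h1 : p ^ r * ((v i).natDegree + w i) ≤ p ^ r * n := Nat.mul_le_mul_left _ (by omega)
      rw [mul_add] at h1
      omega
  · have h1 := congrArg (· ^ p ^ r) hs
    simp only [add_pow_char_pow, mul_pow, ← pow_mul, zero_pow hq.ne'] at h1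
    rwa [mul_comm (p ^ r) (w 0), mul_comm (p ^ r) (w 2), pow_mul, pow_mul, ← pow_mul, ← pow_mul]

lemma syz_ne_bot_of_shift {w w' : Fin 3 → ℕ} {n : ℕ} (h : syz k w n ≠ ⊥) :
    syz k w' (n + ((w' 0 - w 0) + (w' 1 - w 1) + (w' 2 - w 2))) ≠ ⊥ := by
  obtain ⟨v, hv, hv0⟩ := Submodule.exists_mem_ne_zero_of_ne_bot h
  obtain ⟨hd, hs⟩ := mem_syz.mp hv
  have hX : ∀ m, (X : k[X]) ^ m ≠ 0 := fun m => pow_ne_zero _ X_ne_zero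
  have hY : ∀ m, (X + 1 : k[X]) ^ m ≠ 0 := fun m => pow_ne_zero _ X_add_one_ne_zero
  have hdeg : ∀ r s, (X ^ r * (X + 1) ^ s : k[X]).natDegree ≤ r + s := fun r s => by
    rw [natDegree_mul (hX r) (hY s), natDegree_X_pow, natDegree_X_add_one_pow]
  refine (Submodule.ne_bot_iff _).mpr
    ⟨![v 0 * (X ^ (w 0 - w' 0) * (X + 1) ^ (w' 2 - w 2)),
      v 1 * (X ^ (w' 0 - w 0) * (X + 1) ^ (w' 2 - w 2)),
      v 2 * (X ^ (w' 0 - w 0) * (X + 1) ^ (w 2 - w' 2))], mem_syz.mpr ⟨fun i => ?_, ?_⟩, ?_⟩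
  · fin_cases i
    · exact mul_mem_degreeLT (hd 0) (hdeg _ _) (by simp only [Fin.zero_eta]; omega)
    · exact mul_mem_degreeLT (hd 1) (hdeg _ _) (by simp only [Fin.mk_one]; omega)
    · exact mul_mem_degreeLT (hd 2) (hdeg _ _) (by simp only [Fin.reduceFinMk]; omega)
  · have e0 : (X : k[X]) ^ w' 0 * X ^ (w 0 - w' 0) = X ^ w 0 * X ^ (w' 0 - w 0) := by
      rw [← pow_add, ← pow_add]; congr 1; omega
    have e2 : (X + 1 : k[X]) ^ w' 2 * (X + 1) ^ (w 2 - w' 2) =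
        (X + 1) ^ w 2 * (X + 1) ^ (w' 2 - w 2) := by
      rw [← pow_add, ← pow_add]; congr 1; omega
    simp only [Matrix.cons_val_zero, Matrix.cons_val_one, Matrix.cons_val]
    linear_combination (v 0 * (X + 1) ^ (w' 2 - w 2)) * e0 + (v 2 * X ^ (w' 0 - w 0)) * e2 +
      (X ^ (w' 0 - w 0) * (X + 1) ^ (w' 2 - w 2)) * hs
  · intro h0
    apply hv0
    ext1 i
    have h1 := congrFun h0 i
    fin_cases i
    · exact (mul_eq_zero.mp h1).resolve_right (mul_ne_zero (hX _) (hY _))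
    · exact (mul_eq_zero.mp h1).resolve_right (mul_ne_zero (hX _) (hY _))
    · exact (mul_eq_zero.mp h1).resolve_right (mul_ne_zero (hX _) (hY _))

lemma abs_natCast_sub (x y : ℕ) : |(x : ℝ) - y| = 2 * ((x - y : ℕ) : ℝ) - ((x : ℝ) - y) := by
  rcases le_total x y with h | h
  · have h' : (x : ℝ) ≤ y := by exact_mod_cast h
    rw [abs_of_nonpos (by linarith), Nat.sub_eq_zero_of_le h]
    push_cast
    ring
  · have h' : (y : ℝ) ≤ x := by exact_mod_cast h
    rw [abs_of_nonneg (by linarith), Nat.cast_sub h]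
    ring

/-- The lower bound for the syzygy gap coming from Frobenius powers of the syzygies of odd
triples. -/
lemma hanDelta_le_gap {p : ℕ} (hp : p.Prime) [CharP k p] {w : Fin 3 → ℕ} {β : ℕ}
    (hβ : ∀ n, syz k w n ≠ ⊥ → β ≤ n) :
    hanDelta p (fun i => (w i : ℝ)) ≤ (w 0 + w 1 + w 2 : ℝ) - 2 * β := by
  have hβ1 : 2 * β ≤ w 0 + w 1 + w 2 := by
    have := hβ ((w 0 + w 1 + w 2) / 2) (syz_ne_bot (by omega))
    omega
  have hβ2 : (2 * β : ℝ) ≤ w 0 + w 1 + w 2 := by exact_mod_cast hβ1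
  have hp1 : (1 : ℝ) ≤ p := by exact_mod_cast hp.one_le
  have hp0 : (0 : ℝ) < p := by linarith
  refine hanDelta_le hp.pos (by linarith) fun s u hu => ?_
  obtain ⟨r, rfl | rfl⟩ := s.eq_nat_or_neg
  · obtain ⟨m, hm⟩ := hu
    have h1 : syz k u m ≠ ⊥ := syz_ne_bot (by omega)
    obtain ⟨v, hv, hv0⟩ := Submodule.exists_mem_ne_zero_of_ne_bot h1
    have h2 : syz k (fun i => p ^ r * u i) (p ^ r * m) ≠ ⊥ := by
      refine (Submodule.ne_bot_iff _).mpr ⟨_, syz_frobenius hp hv r, fun h => hv0 ?_⟩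
      ext1 i
      exact eq_zero_of_pow_eq_zero (congrFun h i)
    have h3 := hβ _ (syz_ne_bot_of_shift (w' := w) h2)
    have h4 : (β : ℝ) ≤ p ^ r * m + (((w 0 - p ^ r * u 0 : ℕ) : ℝ) +
      ((w 1 - p ^ r * u 1 : ℕ) : ℝ) + ((w 2 - p ^ r * u 2 : ℕ) : ℝ)) := by exact_mod_cast h3
    have h5 : ∀ i, |(w i : ℝ) - (p : ℝ) ^ r * u i| =
        2 * ((w i - p ^ r * u i : ℕ) : ℝ) - ((w i : ℝ) - (p : ℝ) ^ r * u i) := fun i => by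
      have := abs_natCast_sub (w i) (p ^ r * u i)
      push_cast at this
      exact this
    have h6 : (u 0 + u 1 + u 2 : ℝ) = 2 * m + 1 := by exact_mod_cast hm
    simp only [zpow_natCast, Fin.sum_univ_three, h5]
    have h7 : (p : ℝ) ^ r * u 0 + (p : ℝ) ^ r * u 1 + (p : ℝ) ^ r * u 2 =
        2 * ((p : ℝ) ^ r * m) + (p : ℝ) ^ r := by
      linear_combination (p : ℝ) ^ r * h6
    linarith
  · have hq : (0 : ℝ) < (p : ℝ) ^ r := by positivity
    have hq1 : (p : ℝ) ^ (-(r : ℤ)) ≤ 1 := zpow_le_one_of_nonpos₀ hp1 (by simp)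
    by_cases h : ∀ i, p ^ r * w i = u i
    · have h1 : Odd (w 0 + w 1 + w 2) := by
        rw [← h 0, ← h 1, ← h 2, ← mul_add, ← mul_add] at hu
        exact Nat.Odd.of_mul_right hu
      have h2 : 2 * β + 1 ≤ w 0 + w 1 + w 2 := by
        obtain ⟨m, hm⟩ := h1
        omega
      have h3 : (2 * β + 1 : ℝ) ≤ w 0 + w 1 + w 2 := by exact_mod_cast h2
      have h4 : (0 : ℝ) ≤ ∑ i, |(w i : ℝ) - (p : ℝ) ^ (-(r : ℤ)) * u i| :=
        Finset.sum_nonneg fun i _ => abs_nonneg _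
      linarith
    · push Not at h
      obtain ⟨i, hi⟩ := h
      have h1 : (1 : ℝ) ≤ |(p : ℝ) ^ r * w i - u i| := by
        have : ((p ^ r * w i : ℕ) : ℤ) - (u i : ℕ) ≠ 0 := by
          rw [sub_ne_zero]; exact_mod_cast hi
        exact_mod_cast Int.one_le_abs this
      have h2 : |(w i : ℝ) - (p : ℝ) ^ (-(r : ℤ)) * u i| =
          (p : ℝ) ^ (-(r : ℤ)) * |(p : ℝ) ^ r * w i - u i| := by
        rw [zpow_neg, zpow_natCast]
        nth_rewrite 2 [← abs_of_pos (inv_pos.mpr hq)]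
        rw [← abs_mul]
        congr 1
        field_simp
      have h3 : |(w i : ℝ) - (p : ℝ) ^ (-(r : ℤ)) * u i| ≤
          ∑ i, |(w i : ℝ) - (p : ℝ) ^ (-(r : ℤ)) * u i| :=
        Finset.single_le_sum (f := fun i => |(w i : ℝ) - (p : ℝ) ^ (-(r : ℤ)) * u i|)
          (fun i _ => abs_nonneg _) (Finset.mem_univ i)
      have h4 : (p : ℝ) ^ (-(r : ℤ)) * 1 ≤
          (p : ℝ) ^ (-(r : ℤ)) * |(p : ℝ) ^ r * w i - u i| :=
        mul_le_mul_of_nonneg_left h1 (by positivity)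
      linarith

lemma gap_le_hanDelta_of_syz [IsAlgClosed k] {p : ℕ} (hp : p.Prime) [CharP k p]
    {w : Fin 3 → ℕ} {β : ℕ} {v : Fin 3 → k[X]} (hv : v ∈ syz k w β) (hv0 : ∀ i, v i ≠ 0) :
    (w 0 + w 1 + w 2 : ℝ) - 2 * β ≤ hanDelta p ![(w 0 : ℝ), w 1, w 2] := by
  obtain ⟨hd, hs⟩ := mem_syz.mp hv
  have hdeg : ∀ i, (v i).natDegree + w i ≤ β := fun i => by
    have := (mem_degreeLT_iff.mp (hd i)).resolve_left (hv0 i)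
    omega
  have hX : (X : k[X]) ^ w 0 ≠ 0 := pow_ne_zero _ X_ne_zero
  have hY : (X + 1 : k[X]) ^ w 2 ≠ 0 := pow_ne_zero _ X_add_one_ne_zero
  refine gap_le_hanDelta hp β (mul_ne_zero hX (hv0 0)) (hv0 1) (mul_ne_zero hY (hv0 2)) hs ?_ ?_
    (by simp) (hdeg 1) (by simp)
  · rw [natDegree_mul hX (hv0 0), natDegree_X_pow]
    linarith [hdeg 0]
  · rw [natDegree_mul hY (hv0 2), natDegree_X_add_one_pow]
    linarith [hdeg 2]

lemma two_mul_sum_tsub (w N : ℕ) :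
    2 * ∑ n ∈ Finset.range N, ((n + 1 - w : ℕ) : ℤ) = ((N - w : ℕ) : ℤ) * ((N - w : ℕ) + 1) := by
  induction N with
  | zero => simp
  | succ N ih =>
    rw [Finset.sum_range_succ, mul_add, ih]
    rcases le_or_gt w N with h | h
    · rw [Nat.cast_sub h, Nat.cast_sub (h.trans (Nat.le_succ N))]
      push_cast
      ring
    · rw [Nat.sub_eq_zero_of_le h.le, Nat.sub_eq_zero_of_le (by omega : N + 1 ≤ w)]
      simp

lemma two_mul_sum_coDim {w : Fin 3 → ℕ} {α β N : ℕ} (hα : 0 < α)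
    (hf : ∀ n < α, Module.finrank k (syz k w n) = n + 1 - β) (hN : α ≤ N)
    (h0 : coDim k w (α - 1) = 0) :
    2 * ∑ n ∈ Finset.range N, (coDim k w n : ℤ) = α * (α + 1)
      - ((α - w 0 : ℕ) : ℤ) * ((α - w 0 : ℕ) + 1) - ((α - w 1 : ℕ) : ℤ) * ((α - w 1 : ℕ) + 1)
      - ((α - w 2 : ℕ) : ℤ) * ((α - w 2 : ℕ) + 1)
      + ((α - β : ℕ) : ℤ) * ((α - β : ℕ) + 1) := by
  have h1 : ∑ n ∈ Finset.range N, (coDim k w n : ℤ) = ∑ n ∈ Finset.range α, (coDim k w n : ℤ) := by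
    refine (Finset.sum_subset (Finset.range_mono hN) fun n _ hn => ?_).symm
    rw [Finset.mem_range, not_lt] at hn
    rw [coDim_eq_zero_of_le h0 (by omega), Nat.cast_zero]
  have h2 : ∀ n ∈ Finset.range α, (coDim k w n : ℤ) = ((n + 1 - 0 : ℕ) : ℤ)
      - ((n + 1 - w 0 : ℕ) : ℤ) - ((n + 1 - w 1 : ℕ) : ℤ)
      - ((n + 1 - w 2 : ℕ) : ℤ) + ((n + 1 - β : ℕ) : ℤ) := fun n hn => by
    rw [coDim_eq, hf n (Finset.mem_range.mp hn)]
    push_cast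
    ring
  rw [h1, Finset.sum_congr rfl h2, Finset.sum_add_distrib, Finset.sum_sub_distrib,
    Finset.sum_sub_distrib, Finset.sum_sub_distrib, mul_add, mul_sub, mul_sub, mul_sub]
  simp only [two_mul_sum_tsub]
  simp only [Nat.sub_zero]

/-- The value of the sum of the codimensions when the triangle inequality fails at `i`. -/
lemma four_mul_sum_coDim_of_le {w : Fin 3 → ℕ} (hw : ∀ i, 0 < w i) {i : Fin 3}
    (hi : w 0 + w 1 + w 2 ≤ 2 * w i) {N : ℕ} (hN : w 0 + w 1 + w 2 ≤ N) :
    4 * ∑ n ∈ Finset.range N, (coDim k w n : ℤ) = 2 * (w 0 * w 1 + w 0 * w 2 + w 1 * w 2)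
      - (w 0 ^ 2 + w 1 ^ 2 + w 2 ^ 2) + (2 * w i - (w 0 + w 1 + w 2)) ^ 2 := by
  have h0 := hw 0
  have h1 := hw 1
  have h2 := hw 2
  have hle : w i ≤ w 0 + w 1 + w 2 := by fin_cases i <;> simp <;> omega
  have hf : ∀ n < w 0 + w 1 + w 2 - w i,
      Module.finrank k (syz k w n) = n + 1 - (w 0 + w 1 + w 2 - w i) := fun n hn => by
    have : syz k w n = ⊥ := by
      rw [eq_bot_iff]
      intro v hv
      exact syz_eq_zero_of_apply_eq_zero hv (apply_eq_zero_of_mem_syz hv (i := i) (by omega))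
        (by omega)
    rw [this, finrank_bot]
    omega
  have hpos : 0 < w 0 + w 1 + w 2 - w i := by fin_cases i <;> simp <;> omega
  have h3 : coDim k w (w 0 + w 1 + w 2 - w i - 1) = 0 := by
    have h4 := coDim_eq (k := k) w (w 0 + w 1 + w 2 - w i - 1)
    rw [hf _ (by omega)] at h4
    fin_cases i <;> simp at * <;> omega
  have h5 := two_mul_sum_coDim (k := k) (w := w) hpos hf (by omega : _ ≤ N) h3
  rw [Nat.sub_self] at h5
  have hcast : ((w 0 + w 1 + w 2 - w i : ℕ) : ℤ) = w 0 + w 1 + w 2 - w i := by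
    push_cast [hle]
    ring
  rw [hcast] at h5
  fin_cases i
  · simp only [Fin.zero_eta, Fin.isValue] at *
    rw [show w 0 + w 1 + w 2 - w 0 - w 0 = 0 by omega,
      show w 0 + w 1 + w 2 - w 0 - w 1 = w 2 by omega,
      show w 0 + w 1 + w 2 - w 0 - w 2 = w 1 by omega] at h5
    linear_combination 2 * h5
  · simp only [Fin.mk_one, Fin.isValue] at *
    rw [show w 0 + w 1 + w 2 - w 1 - w 0 = w 2 by omega,
      show w 0 + w 1 + w 2 - w 1 - w 1 = 0 by omega,
      show w 0 + w 1 + w 2 - w 1 - w 2 = w 0 by omega] at h5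
    linear_combination 2 * h5
  · simp only [Fin.reduceFinMk, Fin.isValue] at *
    rw [show w 0 + w 1 + w 2 - w 2 - w 0 = w 1 by omega,
      show w 0 + w 1 + w 2 - w 2 - w 1 = w 0 by omega,
      show w 0 + w 1 + w 2 - w 2 - w 2 = 0 by omega] at h5
    linear_combination 2 * h5

/-- The value of the sum of the codimensions when all triangle inequalities hold. -/
lemma four_mul_sum_coDim_of_lt [IsAlgClosed k] {p : ℕ} (hp : p.Prime) [CharP k p]
    {w : Fin 3 → ℕ} (hw : ∀ i, 0 < w i) (hi : ∀ i, 2 * w i < w 0 + w 1 + w 2) {N : ℕ}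
    (hN : w 0 + w 1 + w 2 ≤ N) :
    4 * ∑ n ∈ Finset.range N, (coDim k w n : ℝ) = 2 * (w 0 * w 1 + w 0 * w 2 + w 1 * w 2)
      - (w 0 ^ 2 + w 1 ^ 2 + w 2 ^ 2) + hanDelta p ![(w 0 : ℝ), w 1, w 2] ^ 2 := by
  classical
  have hex : ∃ n, syz k w n ≠ ⊥ := ⟨w 0 + w 1 + w 2, syz_ne_bot (by omega)⟩
  obtain ⟨β, hβ, hmin⟩ : ∃ β, syz k w β ≠ ⊥ ∧ ∀ n, syz k w n ≠ ⊥ → β ≤ n :=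
    ⟨Nat.find hex, Nat.find_spec hex, fun n hn => Nat.find_min' hex hn⟩
  have hβ2 : 2 * β ≤ w 0 + w 1 + w 2 := by
    have := hmin ((w 0 + w 1 + w 2) / 2) (syz_ne_bot (by omega))
    omega
  obtain ⟨v, hv, hv0⟩ := Submodule.exists_mem_ne_zero_of_ne_bot hβ
  have hvi : ∀ i, v i ≠ 0 := fun i h =>
    hv0 (syz_eq_zero_of_apply_eq_zero hv h (by have := hi i; omega))
  have hwβ : ∀ i, w i ≤ β := fun i => by
    by_contra! h
    exact hvi i (apply_eq_zero_of_mem_syz hv h)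
  have hbot : ∀ n < β, syz k w n = ⊥ := fun n hn => by
    by_contra h
    exact absurd (hmin n h) (by omega)
  have h0 := hw 0
  have hw0 := hwβ 0
  have hw1 := hwβ 1
  have hw2 := hwβ 2
  obtain ⟨m, rfl⟩ : ∃ m, β = m + 1 := ⟨β - 1, by omega⟩
  have hf : ∀ n < w 0 + w 1 + w 2 - (m + 1),
      Module.finrank k (syz k w n) = n + 1 - (m + 1) := by
    intro n hn
    refine le_antisymm ?_ (le_finrank_syz hv hv0)
    induction n with
    | zero => rw [hbot 0 (by omega), finrank_bot]; omega
    | succ n ih =>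
      rcases lt_or_ge n m with h | h
      · rw [hbot _ (by omega), finrank_bot]; omega
      · have h1 := finrank_syz_succ_le hv (by rw [hbot m (by omega)]; simpa using hv0) hwβ h
          (by omega)
        have h2 := ih (by omega)
        omega
  have h3 : coDim k w (w 0 + w 1 + w 2 - (m + 1) - 1) = 0 := by
    have h4 := coDim_eq (k := k) w (w 0 + w 1 + w 2 - (m + 1) - 1)
    rw [hf _ (by omega)] at h4
    omega
  have h5 := two_mul_sum_coDim (k := k) (w := w) (by omega) hf (by omega : _ ≤ N) h3
  have hδ : hanDelta p ![(w 0 : ℝ), w 1, w 2] = (w 0 + w 1 + w 2 : ℝ) - 2 * (m + 1 : ℕ) := by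
    refine le_antisymm ?_ (gap_le_hanDelta_of_syz hp hv hvi)
    have h6 : ![(w 0 : ℝ), w 1, w 2] = fun i => (w i : ℝ) := by
      ext i
      fin_cases i <;> rfl
    rw [h6]
    exact hanDelta_le_gap hp hmin
  have hR := congrArg (Int.cast : ℤ → ℝ) h5
  rw [hδ]
  push_cast [show w 0 ≤ w 0 + w 1 + w 2 - (m + 1) by omega,
    show w 1 ≤ w 0 + w 1 + w 2 - (m + 1) by omega,
    show w 2 ≤ w 0 + w 1 + w 2 - (m + 1) by omega,
    show m + 1 ≤ w 0 + w 1 + w 2 - (m + 1) by omega,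
    show m + 1 ≤ w 0 + w 1 + w 2 by omega] at hR ⊢
  linear_combination 2 * hR

/-- The length of `k[x, y] / (x ^ a, y ^ b, (x + y) ^ c)` in terms of Han's delta function. -/
lemma four_mul_sum_coDim [IsAlgClosed k] {p : ℕ} (hp : p.Prime) [CharP k p]
    {w : Fin 3 → ℕ} (hw : ∀ i, 0 < w i) {N : ℕ} (hN : w 0 + w 1 + w 2 ≤ N) :
    4 * ∑ n ∈ Finset.range N, (coDim k w n : ℝ) = 2 * (w 0 * w 1 + w 0 * w 2 + w 1 * w 2)
      - (w 0 ^ 2 + w 1 ^ 2 + w 2 ^ 2) + hanDelta p ![(w 0 : ℝ), w 1, w 2] ^ 2 := by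
  by_cases h : ∀ i, 2 * w i < w 0 + w 1 + w 2
  · exact four_mul_sum_coDim_of_lt hp hw h hN
  push Not at h
  obtain ⟨i, hi⟩ := h
  have hR := congrArg (Int.cast : ℤ → ℝ) (four_mul_sum_coDim_of_le (k := k) hw hi hN)
  push_cast at hR
  rw [hR]
  congr 2
  have hi' : (w 0 + w 1 + w 2 : ℝ) ≤ 2 * w i := by exact_mod_cast hi
  have hn : ∀ i, (0 : ℝ) ≤ w i := fun i => Nat.cast_nonneg _
  fin_cases i
  · simp only [Fin.zero_eta, Fin.isValue] at *
    rw [hanDelta_eq_of_add_le hp.one_lt (hn 1) (hn 2) (by linarith)]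
    ring
  · simp only [Fin.mk_one, Fin.isValue] at *
    rw [hanDelta_swap₀₁ hp.pos, hanDelta_eq_of_add_le hp.one_lt (hn 0) (hn 2) (by linarith)]
    ring
  · simp only [Fin.reduceFinMk, Fin.isValue] at *
    rw [hanDelta_swap₀₂ hp.pos, hanDelta_eq_of_add_le hp.one_lt (hn 1) (hn 0) (by linarith)]
    ring

section EvalHomogenize

variable {A : Type*} [CommRing A] [Algebra k A]

/-- Homogenize a polynomial to degree `n` and evaluate at `(x, y)`. -/
def evalHomogenize (x y : A) (n : ℕ) : k[X] →ₗ[k] A :=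
  (MvPolynomial.aeval ![x, y]).toLinearMap ∘ₗ homogenizeLM n

lemma evalHomogenize_X_pow (x y : A) {m n : ℕ} (h : m ≤ n) :
    evalHomogenize (k := k) x y n (X ^ m) = x ^ m * y ^ (n - m) := by
  simp [evalHomogenize, homogenize_X_pow h]

lemma evalHomogenize_mul (x y : A) {f g : k[X]} {m n : ℕ} (hf : f.natDegree ≤ m)
    (hg : g.natDegree ≤ n) :
    evalHomogenize x y (m + n) (f * g) = evalHomogenize x y m f * evalHomogenize x y n g := by
  simp [evalHomogenize, homogenize_mul f g hf hg]

lemma evalHomogenize_X_add_one_pow (x y : A) (c : ℕ) :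
    evalHomogenize (k := k) x y c ((X + 1) ^ c) = (x + y) ^ c := by
  induction c with
  | zero => simp [evalHomogenize]
  | succ c ih =>
    rw [pow_succ, evalHomogenize_mul x y (natDegree_X_add_one_pow c).le
      (by simpa using (natDegree_X_add_one_pow (k := k) 1).le), ih, pow_succ, map_add]
    simp [evalHomogenize]

lemma evalHomogenize_neg_X_add_one_pow (x y : A) (c : ℕ) :
    evalHomogenize (k := k) x y c ((-(X + 1)) ^ c) = (-(x + y)) ^ c := by
  rw [neg_pow, neg_pow (x + y), ← evalHomogenize_X_add_one_pow (k := k) x y]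
  rcases Nat.even_or_odd c with hc | hc <;> simp [hc.neg_one_pow]

lemma natDegree_neg_X_add_one_pow (c : ℕ) : ((-(X + 1) : k[X]) ^ c).natDegree = c := by
  rw [natDegree_pow, natDegree_neg, ← natDegree_pow, natDegree_X_add_one_pow]

lemma map_evalHomogenize {B : Type*} [CommRing B] [Algebra k B] (F : A →ₐ[k] B) (x y : A) (n : ℕ)
    (f : k[X]) : F (evalHomogenize x y n f) = evalHomogenize (F x) (F y) n f := by
  simp only [evalHomogenize, LinearMap.comp_apply, AlgHom.toLinearMap_apply]
  rw [← AlgHom.comp_apply, MvPolynomial.comp_aeval]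
  congr 2
  ext i
  fin_cases i <;> rfl

lemma mul_evalHomogenize_eq_zero {ε x y : A} {w : Fin 3 → ℕ} (h0 : ε * x ^ w 0 = 0)
    (h1 : ε * y ^ w 1 = 0) (h2 : ε * (x + y) ^ w 2 = 0) {n : ℕ} {f : k[X]}
    (hf : f ∈ idealPart k w n) : ε * evalHomogenize x y n f = 0 := by
  have key : ∀ {m : ℕ} {g v : k[X]}, g.natDegree ≤ m → ε * evalHomogenize x y m g = 0 →
      v ∈ degreeLT k (n + 1 - m) → ε * evalHomogenize x y n (g * v) = 0 := by
    intro m g v hg h hv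
    rcases mem_degreeLT_iff.mp hv with rfl | hv
    · simp
    · rw [show n = m + (n - m) by omega, evalHomogenize_mul x y hg (by omega), ← mul_assoc, h,
        zero_mul]
  obtain ⟨v, hv, rfl⟩ := mem_idealPart.mp hf
  rw [map_add, map_add, mul_add, mul_add, key (natDegree_X_pow_le _) _ (hv 0),
    key (natDegree_X_add_one_pow _).le _ (hv 2), ← one_mul (v 1), key _ _ (hv 1)]
  · simp
  · simp
  · simpa [evalHomogenize] using h1
  · rwa [evalHomogenize_X_add_one_pow]
  · rwa [evalHomogenize_X_pow x y le_rfl, Nat.sub_self, pow_zero, mul_one]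

end EvalHomogenize

variable (k) in
/-- The ideal `(U ^ d₀ + V ^ d₁ + W ^ d₂, U ^ q, V ^ q, W ^ q)` of `k[U, V, W]`. -/
def diagIdeal (d : Fin 3 → ℕ) (q : ℕ) : Ideal (MvPolynomial (Fin 3) k) :=
  diagRel k (d 0) (d 1) (d 2) ⊔ Ideal.span (Set.range fun i => MvPolynomial.X i ^ q)

lemma diagHK_eq_finrank (d₁ d₂ d₃ q : ℕ) :
    diagHK k d₁ d₂ d₃ q =
      Module.finrank k (MvPolynomial (Fin 3) k ⧸ diagIdeal k ![d₁, d₂, d₃] q) := by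
  rw [diagHK, diagIdeal]
  have h : Ideal.span {Ideal.Quotient.mk (diagRel k d₁ d₂ d₃) (MvPolynomial.X 0) ^ q,
        Ideal.Quotient.mk (diagRel k d₁ d₂ d₃) (MvPolynomial.X 1) ^ q,
        Ideal.Quotient.mk (diagRel k d₁ d₂ d₃) (MvPolynomial.X 2) ^ q} =
      (Ideal.span (Set.range fun i : Fin 3 => (MvPolynomial.X i : MvPolynomial (Fin 3) k) ^ q)).map
        (Ideal.Quotient.mkₐ k (diagRel k d₁ d₂ d₃)) := by
    rw [Ideal.map_span, ← Set.range_comp]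
    congr 1
    ext f
    simp [Fin.exists_fin_succ, eq_comm]
  rw [h]
  exact (DoubleQuot.quotQuotEquivQuotSupₐ k _ _).toLinearEquiv.finrank_eq

variable (k) in
/-- The component, in residue class `i` modulo `d` and degree `n`, of the map sending the monomial
`U ^ m₀ V ^ m₁ W ^ m₂` to `X ^ (m₀ / d₀) * (-(X + 1)) ^ (m₂ / d₂)`. -/
def diagComponent (d i : Fin 3 → ℕ) (n : ℕ) : MvPolynomial (Fin 3) k →ₗ[k] k[X] :=
  (MvPolynomial.basisMonomials (Fin 3) k).constr k fun m =>
    if (∀ j, m j % d j = i j) ∧ m 0 / d 0 + m 1 / d 1 + m 2 / d 2 = n then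
      X ^ (m 0 / d 0) * (-(X + 1)) ^ (m 2 / d 2) else 0

lemma diagComponent_monomial (d i : Fin 3 → ℕ) (n : ℕ) (m : Fin 3 →₀ ℕ) :
    diagComponent k d i n (MvPolynomial.monomial m 1) =
      if (∀ j, m j % d j = i j) ∧ m 0 / d 0 + m 1 / d 1 + m 2 / d 2 = n then
        X ^ (m 0 / d 0) * (-(X + 1)) ^ (m 2 / d 2) else 0 := by
  have h : MvPolynomial.monomial m (1 : k) = MvPolynomial.basisMonomials (Fin 3) k m := by simp
  rw [diagComponent, h, Module.Basis.constr_basis]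

lemma map_mul_mem_of_monomial {M : Type*} [AddCommGroup M] [Module k M] {σ : Type*}
    (F : MvPolynomial σ k →ₗ[k] M) (S : Submodule k M) (g : MvPolynomial σ k)
    (h : ∀ m, F (MvPolynomial.monomial m 1 * g) ∈ S) (f : MvPolynomial σ k) : F (f * g) ∈ S := by
  induction f using MvPolynomial.induction_on' with
  | monomial m c =>
    have hc : MvPolynomial.monomial m c = c • MvPolynomial.monomial m (1 : k) := by
      rw [MvPolynomial.smul_monomial, smul_eq_mul, mul_one]
    rw [hc, smul_mul_assoc, map_smul]
    exact S.smul_mem c (h m)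
  | add f f' hf hf' =>
    rw [add_mul, map_add]
    exact S.add_mem hf hf'

lemma diagComponent_mul_rel {d : Fin 3 → ℕ} (hd : ∀ j, 0 < d j) (i : Fin 3 → ℕ) (n : ℕ)
    (f : MvPolynomial (Fin 3) k) :
    diagComponent k d i n (f * (MvPolynomial.X 0 ^ d 0 + MvPolynomial.X 1 ^ d 1 +
      MvPolynomial.X 2 ^ d 2)) = 0 := by
  rw [← Submodule.mem_bot k]
  refine map_mul_mem_of_monomial _ _ _ (fun m => ?_) f
  have hmod : ∀ j j', (m + Finsupp.single j (d j)) j' % d j' = m j' % d j' := fun j j' => by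
    rcases eq_or_ne j j' with rfl | h <;> simp [*]
  simp only [mul_add, map_add, MvPolynomial.X_pow_eq_monomial, MvPolynomial.monomial_mul, one_mul,
    diagComponent_monomial, hmod]
  simp only [Finsupp.add_apply, Finsupp.single_apply, Fin.isValue, if_true,
    Fin.reduceEq, if_false, add_zero, Nat.add_div_right _ (hd _), Submodule.mem_bot]
  rw [show m 0 / d 0 + 1 + m 1 / d 1 + m 2 / d 2 = m 0 / d 0 + m 1 / d 1 + m 2 / d 2 + 1 by ring,
    show m 0 / d 0 + (m 1 / d 1 + 1) + m 2 / d 2 = m 0 / d 0 + m 1 / d 1 + m 2 / d 2 + 1 by ring,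
    ← add_assoc]
  split_ifs
  · ring
  · simp

lemma X_pow_mul_mem_idealPart {w : Fin 3 → ℕ} {s t r : ℕ}
    (h : w 0 ≤ s ∨ w 1 ≤ t ∨ w 2 ≤ r) :
    (X ^ s * (-(X + 1)) ^ r : k[X]) ∈ idealPart k w (s + t + r) := by
  have hdeg : ∀ a b n, a + b < n → (X ^ a * (-(X + 1)) ^ b : k[X]) ∈ degreeLT k n :=
    fun a b n hn => mem_degreeLT_iff.mpr <| .inr <| (natDegree_mul_le.trans (add_le_add
      (natDegree_X_pow_le a) (natDegree_neg_X_add_one_pow b).le)).trans_lt hn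
  refine mem_idealPart.mpr ?_
  rcases h with h | h | h
  · refine ⟨![X ^ (s - w 0) * (-(X + 1)) ^ r, 0, 0], fun j => ?_, ?_⟩
    · fin_cases j
      · exact hdeg _ _ _ (by simp; omega)
      · exact Submodule.zero_mem _
      · exact Submodule.zero_mem _
    · simp only [Matrix.cons_val_zero, Matrix.cons_val_one, Matrix.cons_val, mul_zero, add_zero]
      rw [← mul_assoc, ← pow_add, Nat.add_sub_cancel' h]
  · refine ⟨![0, X ^ s * (-(X + 1)) ^ r, 0], fun j => ?_, ?_⟩
    · fin_cases j
      · exact Submodule.zero_mem _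
      · exact hdeg _ _ _ (by simp; omega)
      · exact Submodule.zero_mem _
    · simp
  · refine ⟨![0, 0, (-1) ^ w 2 * (X ^ s * (-(X + 1)) ^ (r - w 2))], fun j => ?_, ?_⟩
    · fin_cases j
      · exact Submodule.zero_mem _
      · exact Submodule.zero_mem _
      · have h1 := hdeg s (r - w 2) (s + t + r + 1 - w 2) (by omega)
        rcases neg_one_pow_eq_or k[X] (w 2) with h2 | h2
        · rw [h2, one_mul]
          exact h1
        · rw [h2, neg_mul, one_mul]
          exact Submodule.neg_mem _ h1
    · simp only [Matrix.cons_val_zero, Matrix.cons_val_one, Matrix.cons_val, mul_zero, zero_add]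
      obtain ⟨r, rfl⟩ := Nat.exists_eq_add_of_le h
      rw [Nat.add_sub_cancel_left, pow_add, neg_pow (X + 1 : k[X]) (w 2)]
      ring

/-- The exponents of the trinomial ideal attached to the residue class `i`. -/
def diagExponent (d : Fin 3 → ℕ) (q : ℕ) (i : Fin 3 → ℕ) : Fin 3 → ℕ :=
  fun j => (q - i j) ⌈/⌉ d j

lemma diagComponent_mul_X_pow_mem {d : Fin 3 → ℕ} (hd : ∀ j, 0 < d j) (q : ℕ) (i : Fin 3 → ℕ)
    (n : ℕ) (j : Fin 3) (f : MvPolynomial (Fin 3) k) :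
    diagComponent k d i n (f * MvPolynomial.X j ^ q) ∈ idealPart k (diagExponent d q i) n := by
  refine map_mul_mem_of_monomial _ _ _ (fun m => ?_) f
  rw [MvPolynomial.X_pow_eq_monomial, MvPolynomial.monomial_mul, one_mul, diagComponent_monomial]
  split_ifs with h
  swap
  · exact Submodule.zero_mem _
  obtain ⟨h1, h2⟩ := h
  have hj : diagExponent d q i j ≤ (m + Finsupp.single j q) j / d j := by
    rw [diagExponent, ceilDiv_le_iff_le_mul (hd j), ← h1 j]
    have h3 := Nat.mod_add_div ((m + Finsupp.single j q) j) (d j)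
    have h4 : q ≤ (m + Finsupp.single j q) j := by simp
    omega
  rw [← h2]
  refine X_pow_mul_mem_idealPart ?_
  fin_cases j
  · exact .inl hj
  · exact .inr (.inl hj)
  · exact .inr (.inr hj)

lemma diagComponent_mem_of_mem {d : Fin 3 → ℕ} (hd : ∀ j, 0 < d j) (q : ℕ) (i : Fin 3 → ℕ)
    (n : ℕ) {f : MvPolynomial (Fin 3) k} (hf : f ∈ diagIdeal k d q) :
    diagComponent k d i n f ∈ idealPart k (diagExponent d q i) n := by
  obtain ⟨f₁, hf₁, f₂, hf₂, rfl⟩ := Submodule.mem_sup.mp hf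
  rw [map_add]
  refine Submodule.add_mem _ ?_ ?_
  · obtain ⟨g, rfl⟩ := Ideal.mem_span_singleton'.mp hf₁
    rw [diagComponent_mul_rel hd]
    exact Submodule.zero_mem _
  · obtain ⟨c, rfl⟩ := (Submodule.mem_span_range_iff_exists_fun _).mp hf₂
    rw [map_sum]
    exact Submodule.sum_mem _ fun j _ => diagComponent_mul_X_pow_mem hd q i n j (c j)

variable (k) in
/-- The map sending a polynomial to `U ^ i₀ V ^ i₁ W ^ i₂` times its homogenization in degree `n`,
evaluated at `(U ^ d₀, V ^ d₁)`. -/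
def diagLift (d i : Fin 3 → ℕ) (n : ℕ) : k[X] →ₗ[k] MvPolynomial (Fin 3) k :=
  LinearMap.mulLeft k (∏ j, MvPolynomial.X j ^ i j) ∘ₗ
    evalHomogenize (MvPolynomial.X 0 ^ d 0) (MvPolynomial.X 1 ^ d 1) n

lemma diagLift_apply (d i : Fin 3 → ℕ) (n : ℕ) (f : k[X]) :
    diagLift k d i n f = (∏ j, MvPolynomial.X j ^ i j) *
      evalHomogenize (MvPolynomial.X 0 ^ d 0) (MvPolynomial.X 1 ^ d 1) n f :=
  rfl

lemma monomial_one_eq_prod (m : Fin 3 →₀ ℕ) :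
    MvPolynomial.monomial m (1 : k) = ∏ j, MvPolynomial.X j ^ m j := by
  rw [MvPolynomial.monomial_eq, map_one, one_mul, Finsupp.prod_fintype _ _ fun j => pow_zero _]

lemma diagComponent_diagLift_X_pow {d i' : Fin 3 → ℕ} (hi' : ∀ j, i' j < d j) (i : Fin 3 → ℕ)
    (n : ℕ) {n' s : ℕ} (hs : s ≤ n') :
    diagComponent k d i n (diagLift k d i' n' (X ^ s)) =
      if i' = i ∧ n' = n then X ^ s else 0 := by
  have hpos : ∀ j, 0 < d j := fun j => (Nat.zero_le _).trans_lt (hi' j)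
  let t : Fin 3 → ℕ := ![s, n' - s, 0]
  let m : Fin 3 →₀ ℕ := Finsupp.equivFunOnFinite.symm fun j => i' j + d j * t j
  have hm : ∀ j, m j = i' j + d j * t j := fun j => rfl
  have h1 : diagLift k d i' n' (X ^ s) = MvPolynomial.monomial m 1 := by
    rw [diagLift_apply, evalHomogenize_X_pow _ _ hs, monomial_one_eq_prod, Fin.prod_univ_three,
      Fin.prod_univ_three, hm, hm, hm]
    simp only [t, Matrix.cons_val_zero, Matrix.cons_val_one, Matrix.cons_val, mul_zero, add_zero,
      pow_add, pow_mul]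
    ring
  have hmod : ∀ j, m j % d j = i' j := fun j => by
    rw [hm, Nat.add_mul_mod_self_left, Nat.mod_eq_of_lt (hi' j)]
  have hdiv : ∀ j, m j / d j = t j := fun j => by
    rw [hm, Nat.add_mul_div_left _ _ (hpos j), Nat.div_eq_of_lt (hi' j), zero_add]
  rw [h1, diagComponent_monomial]
  simp only [hmod, hdiv]
  simp only [t, Matrix.cons_val_zero, Matrix.cons_val_one, Matrix.cons_val, add_zero, pow_zero,
    mul_one, Nat.add_sub_cancel' hs, funext_iff]

lemma diagComponent_diagLift {d i' : Fin 3 → ℕ} (hi' : ∀ j, i' j < d j) (i : Fin 3 → ℕ)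
    (n n' : ℕ) {f : k[X]} (hf : f ∈ degreeLT k (n' + 1)) :
    diagComponent k d i n (diagLift k d i' n' f) = if i' = i ∧ n' = n then f else 0 := by
  have hf' : f.natDegree ≤ n' := by
    rcases mem_degreeLT_iff.mp hf with rfl | h
    · simp
    · omega
  refine induction_with_natDegree_le (fun f => diagComponent k d i n (diagLift k d i' n' f) =
    if i' = i ∧ n' = n then f else 0) n' (by simp) (fun s r _ hs => ?_)
    (fun f g _ _ hf hg => ?_) f hf'
  · rw [← smul_eq_C_mul, map_smul, map_smul, diagComponent_diagLift_X_pow hi' i n hs, smul_ite,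
      smul_zero]
  · rw [map_add, map_add, hf, hg]
    split_ifs <;> simp

variable (k) in
/-- The projection of `k[U, V, W]` onto its quotient by `diagIdeal`. -/
abbrev diagMk (d : Fin 3 → ℕ) (q : ℕ) :
    MvPolynomial (Fin 3) k →ₐ[k] MvPolynomial (Fin 3) k ⧸ diagIdeal k d q :=
  Ideal.Quotient.mkₐ k (diagIdeal k d q)

lemma diagMk_X_pow (d : Fin 3 → ℕ) (q : ℕ) (j : Fin 3) {m : ℕ} (hm : q ≤ m) :
    diagMk k d q (MvPolynomial.X j) ^ m = 0 := by
  refine pow_eq_zero_of_le hm ?_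
  rw [← map_pow]
  exact Ideal.Quotient.eq_zero_iff_mem.mpr
    (Ideal.mem_sup_right (Ideal.subset_span (Set.mem_range_self j)))

lemma diagMk_rel (d : Fin 3 → ℕ) (q : ℕ) :
    diagMk k d q (MvPolynomial.X 2) ^ d 2 =
      -(diagMk k d q (MvPolynomial.X 0) ^ d 0 + diagMk k d q (MvPolynomial.X 1) ^ d 1) := by
  have h : diagMk k d q (MvPolynomial.X 0 ^ d 0 + MvPolynomial.X 1 ^ d 1 +
      MvPolynomial.X 2 ^ d 2) = 0 :=
    Ideal.Quotient.eq_zero_iff_mem.mpr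
      (Ideal.mem_sup_left (Ideal.subset_span (Set.mem_singleton _)))
  rw [map_add, map_add, map_pow, map_pow, map_pow] at h
  linear_combination h

lemma diagMk_diagLift (d : Fin 3 → ℕ) (q : ℕ) (i : Fin 3 → ℕ) (n : ℕ) (f : k[X]) :
    diagMk k d q (diagLift k d i n f) = (∏ j, diagMk k d q (MvPolynomial.X j) ^ i j) *
      evalHomogenize (diagMk k d q (MvPolynomial.X 0) ^ d 0)
        (diagMk k d q (MvPolynomial.X 1) ^ d 1) n f := by
  rw [diagLift_apply, map_mul, map_evalHomogenize, map_prod]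
  simp only [map_pow]

lemma mul_pow_eq_zero_of_neg {A : Type*} [CommRing A] {ε z : A} {n : ℕ} (h : ε * (-z) ^ n = 0) :
    ε * z ^ n = 0 := by
  rw [← neg_neg z, neg_pow, mul_left_comm, h, mul_zero]

lemma diagMk_diagLift_eq_zero {d : Fin 3 → ℕ} (hd : ∀ j, 0 < d j) (q : ℕ) (i : Fin 3 → ℕ) {n : ℕ}
    {f : k[X]} (hf : f ∈ idealPart k (diagExponent d q i) n) :
    diagMk k d q (diagLift k d i n f) = 0 := by
  have key : ∀ j, (∏ j, diagMk k d q (MvPolynomial.X j) ^ i j) *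
      (diagMk k d q (MvPolynomial.X j) ^ d j) ^ diagExponent d q i j = 0 := fun j => by
    rw [← Finset.prod_erase_mul _ _ (Finset.mem_univ j), mul_assoc, ← pow_mul, ← pow_add,
      diagMk_X_pow, mul_zero]
    have := (ceilDiv_le_iff_le_mul (hd j)).mp (le_refl (diagExponent d q i j))
    omega
  rw [diagMk_diagLift]
  refine mul_evalHomogenize_eq_zero (key 0) (key 1) ?_ hf
  have h2 := key 2
  rw [diagMk_rel] at h2
  exact mul_pow_eq_zero_of_neg h2

lemma diagMk_monomial (d : Fin 3 → ℕ) (q : ℕ) (m : Fin 3 →₀ ℕ) :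
    diagMk k d q (MvPolynomial.monomial m 1) = diagMk k d q (diagLift k d (fun j => m j % d j)
      (m 0 / d 0 + m 1 / d 1 + m 2 / d 2) (X ^ (m 0 / d 0) * (-(X + 1)) ^ (m 2 / d 2))) := by
  have h : ∀ j, diagMk k d q (MvPolynomial.X j) ^ m j = diagMk k d q (MvPolynomial.X j) ^
      (m j % d j) * (diagMk k d q (MvPolynomial.X j) ^ d j) ^ (m j / d j) := fun j => by
    rw [← pow_mul, ← pow_add, Nat.mod_add_div]
  rw [diagMk_diagLift, evalHomogenize_mul _ _ ((natDegree_X_pow_le _).trans (Nat.le_add_right _ _))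
    (natDegree_neg_X_add_one_pow _).le, evalHomogenize_X_pow _ _ (Nat.le_add_right _ _),
    Nat.add_sub_cancel_left, evalHomogenize_neg_X_add_one_pow, ← diagMk_rel, monomial_one_eq_prod,
    map_prod]
  simp only [map_pow, h, Fin.prod_univ_three]
  ring

lemma diagMk_monomial_eq_zero {d : Fin 3 → ℕ} {q : ℕ} {m : Fin 3 →₀ ℕ}
    (h : 3 * q ≤ m 0 / d 0 + m 1 / d 1 + m 2 / d 2) :
    diagMk k d q (MvPolynomial.monomial m 1) = 0 := by
  obtain ⟨j, hj⟩ : ∃ j, q ≤ m j := by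
    by_contra! h'
    have h0 := (Nat.div_le_self (m 0) (d 0)).trans_lt (h' 0)
    have h1 := (Nat.div_le_self (m 1) (d 1)).trans_lt (h' 1)
    have h2 := (Nat.div_le_self (m 2) (d 2)).trans_lt (h' 2)
    omega
  rw [monomial_one_eq_prod, map_prod]
  refine Finset.prod_eq_zero (Finset.mem_univ j) ?_
  rw [map_pow, diagMk_X_pow d q j hj]

variable (k) in
/-- The piece of the quotient by `diagIdeal` of residue class `i` and degree `n`. -/
abbrev diagPiece (d : Fin 3 → ℕ) (q : ℕ) (i : Fin 3 → ℕ) (n : ℕ) : Type _ :=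
  degreeLT k (n + 1) ⧸ (idealPart k (diagExponent d q i) n).submoduleOf (degreeLT k (n + 1))

lemma finrank_diagPiece (d : Fin 3 → ℕ) (q : ℕ) (i : Fin 3 → ℕ) (n : ℕ) :
    Module.finrank k (diagPiece k d q i n) = coDim k (diagExponent d q i) n := by
  rw [Submodule.finrank_quotient, finrank_degreeLT, coDim,
    (Submodule.submoduleOfEquivOfLe (idealPart_le _ n)).finrank_eq]

variable (k) in
/-- The map from a piece to the quotient by `diagIdeal`. -/
def diagPieceMap {d : Fin 3 → ℕ} (hd : ∀ j, 0 < d j) (q : ℕ) (i : Fin 3 → ℕ) (n : ℕ) :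
    diagPiece k d q i n →ₗ[k] MvPolynomial (Fin 3) k ⧸ diagIdeal k d q :=
  Submodule.liftQ _ ((diagMk k d q).toLinearMap ∘ₗ diagLift k d i n ∘ₗ
    (degreeLT k (n + 1)).subtype) fun _ hf => diagMk_diagLift_eq_zero hd q i hf

lemma diagPieceMap_mk {d : Fin 3 → ℕ} (hd : ∀ j, 0 < d j) (q : ℕ) (i : Fin 3 → ℕ) (n : ℕ)
    (f : degreeLT k (n + 1)) :
    diagPieceMap k hd q i n (Submodule.Quotient.mk f) = diagMk k d q (diagLift k d i n f) :=
  rfl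

variable (k) in
/-- The sum of the maps `diagPieceMap`. -/
def diagSumMap {d : Fin 3 → ℕ} (hd : ∀ j, 0 < d j) (q : ℕ) :
    (∀ x : (∀ j, Fin (d j)) × Fin (3 * q), diagPiece k d q (fun j => x.1 j) x.2) →ₗ[k]
      MvPolynomial (Fin 3) k ⧸ diagIdeal k d q :=
  LinearMap.lsum k _ k fun x => diagPieceMap k hd q (fun j => x.1 j) x.2

lemma diagSumMap_surjective {d : Fin 3 → ℕ} (hd : ∀ j, 0 < d j) (q : ℕ) :
    Function.Surjective (diagSumMap k hd q) := by
  rw [← LinearMap.range_eq_top, eq_top_iff]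
  rintro g -
  obtain ⟨f, rfl⟩ := Ideal.Quotient.mkₐ_surjective k (diagIdeal k d q) g
  rw [← mul_one f]
  refine map_mul_mem_of_monomial (diagMk k d q).toLinearMap _ 1 (fun m => ?_) f
  rw [mul_one, AlgHom.toLinearMap_apply]
  rcases le_or_gt (3 * q) (m 0 / d 0 + m 1 / d 1 + m 2 / d 2) with h | h
  · rw [diagMk_monomial_eq_zero h]
    exact Submodule.zero_mem _
  · rw [diagMk_monomial]
    have hdeg : (X ^ (m 0 / d 0) * (-(X + 1)) ^ (m 2 / d 2) : k[X]) ∈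
        degreeLT k (m 0 / d 0 + m 1 / d 1 + m 2 / d 2 + 1) := by
      refine mem_degreeLT_iff.mpr <| .inr <| (natDegree_mul_le.trans (add_le_add
        (natDegree_X_pow_le _) (natDegree_neg_X_add_one_pow _).le)).trans_lt ?_
      have := Nat.zero_le (m 1 / d 1)
      omega
    let x : (∀ j, Fin (d j)) × Fin (3 * q) := ⟨fun j => ⟨m j % d j, Nat.mod_lt _ (hd j)⟩, ⟨_, h⟩⟩
    refine ⟨Pi.single x (Submodule.Quotient.mk ⟨_, hdeg⟩), ?_⟩
    rw [diagSumMap, LinearMap.lsum_piSingle]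
    rfl

lemma diagSumMap_injective {d : Fin 3 → ℕ} (hd : ∀ j, 0 < d j) (q : ℕ) :
    Function.Injective (diagSumMap k hd q) := by
  refine (injective_iff_map_eq_zero _).mpr fun g hg => ?_
  choose f hf using fun x => Submodule.Quotient.mk_surjective _ (g x)
  have h1 : diagMk k d q (∑ x, diagLift k d (fun j => x.1 j) x.2 (f x)) = 0 := by
    rw [_root_.map_sum, ← hg, diagSumMap, LinearMap.lsum_apply,
      LinearMap.sum_apply]
    refine Finset.sum_congr rfl fun x _ => ?_
    rw [LinearMap.comp_apply, LinearMap.proj_apply, ← hf x, diagPieceMap_mk]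
  refine _root_.funext fun y => ?_
  have h2 := diagComponent_mem_of_mem hd q (fun j => y.1 j) y.2
    (Ideal.Quotient.eq_zero_iff_mem.mp h1)
  rw [_root_.map_sum, Finset.sum_eq_single y,
    diagComponent_diagLift (fun j => (y.1 j).2) _ _ _ (f y).2, if_pos ⟨rfl, rfl⟩] at h2
  · rw [← hf y]
    exact (Submodule.Quotient.mk_eq_zero _).mpr h2
  · intro x _ hxy
    rw [diagComponent_diagLift (fun j => (x.1 j).2) _ _ _ (f x).2, if_neg]
    rintro ⟨h3, h4⟩
    exact hxy (Prod.ext (_root_.funext fun j => Fin.ext (congrFun h3 j)) (Fin.ext h4))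
  · simp

lemma diagHK_eq_sum {d₁ d₂ d₃ : ℕ} (h₁ : 0 < d₁) (h₂ : 0 < d₂) (h₃ : 0 < d₃) (q : ℕ) :
    diagHK k d₁ d₂ d₃ q = ∑ i : ∀ j, Fin (![d₁, d₂, d₃] j), ∑ n ∈ Finset.range (3 * q),
      coDim k (diagExponent ![d₁, d₂, d₃] q fun j => i j) n := by
  have hd : ∀ j, 0 < ![d₁, d₂, d₃] j := fun j => by fin_cases j <;> assumption
  have (x : (∀ j, Fin (![d₁, d₂, d₃] j)) × Fin (3 * q)) :
      Module.Free k (diagPiece k ![d₁, d₂, d₃] q (fun j => x.1 j) x.2) :=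
    Module.Free.of_divisionRing _ _
  have (x : (∀ j, Fin (![d₁, d₂, d₃] j)) × Fin (3 * q)) :
      Module.Finite k (diagPiece k ![d₁, d₂, d₃] q (fun j => x.1 j) x.2) :=
    inferInstance
  rw [diagHK_eq_finrank, ← (LinearEquiv.ofBijective (diagSumMap k hd q)
    ⟨diagSumMap_injective hd q, diagSumMap_surjective hd q⟩).finrank_eq,
    Module.finrank_pi_fintype, Fintype.sum_prod_type]
  refine Finset.sum_congr rfl fun i _ => ?_
  rw [Finset.sum_range]
  exact Finset.sum_congr rfl fun n _ => finrank_diagPiece _ _ _ _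

end Polynomial

lemma natCast_mul_ceilDiv_mem_Icc {d : ℕ} (hd : 0 < d) {i : ℕ} (hi : i < d) (q : ℕ) :
    ((d * ((q - i) ⌈/⌉ d) : ℕ) : ℝ) ∈ Set.Icc ((q : ℝ) - d) (q + d) := by
  have h1 := (ceilDiv_le_iff_le_mul (b := q - i) hd).mp le_rfl
  have h2 : (q - i) ⌈/⌉ d ≤ q / d + 1 := by
    rw [ceilDiv_le_iff_le_mul hd]
    have := Nat.lt_mul_div_succ q hd
    omega
  have h3 := Nat.mul_le_mul_left d h2
  have h4 := Nat.mul_div_le q d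
  rw [mul_add, mul_one] at h3
  have h5 : q ≤ d * ((q - i) ⌈/⌉ d) + d := by omega
  have h6 : d * ((q - i) ⌈/⌉ d) ≤ q + d := by omega
  constructor
  · rw [sub_le_iff_le_add]
    exact_mod_cast h5
  · exact_mod_cast h6

lemma tendsto_ceilDiv_div_pow {p : ℕ} (hp : 1 < p) {d : ℕ} (hd : 0 < d) {i : ℕ} (hi : i < d) :
    Filter.Tendsto (fun e : ℕ => (((p ^ e - i) ⌈/⌉ d : ℕ) : ℝ) / (p : ℝ) ^ e) Filter.atTop
      (nhds (1 / (d : ℝ))) := by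
  have hp0 : (0 : ℝ) < p := by exact_mod_cast (zero_lt_one.trans hp)
  have hd0 : (0 : ℝ) < d := by exact_mod_cast hd
  have h0 : Filter.Tendsto (fun e : ℕ => ((p : ℝ)⁻¹) ^ e) Filter.atTop (nhds 0) :=
    tendsto_pow_atTop_nhds_zero_of_lt_one (by positivity)
      (inv_lt_one_of_one_lt₀ (by exact_mod_cast hp))
  refine tendsto_of_tendsto_of_tendsto_of_le_of_le
    (g := fun e => 1 / (d : ℝ) - ((p : ℝ)⁻¹) ^ e) (h := fun e => 1 / (d : ℝ) + ((p : ℝ)⁻¹) ^ e)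
    (by simpa using h0.const_sub (1 / (d : ℝ))) (by simpa using h0.const_add (1 / (d : ℝ)))
    (fun e => ?_) (fun e => ?_)
  all_goals
    obtain ⟨h1, h2⟩ := natCast_mul_ceilDiv_mem_Icc hd hi (p ^ e)
    push_cast at h1 h2
    have hq : (0 : ℝ) < (p : ℝ) ^ e := by positivity
    dsimp only
  · rw [le_div_iff₀ hq, inv_pow, sub_mul, inv_mul_cancel₀ hq.ne', one_div_mul_eq_div,
      sub_le_iff_le_add, div_le_iff₀ hd0]
    linarith
  · rw [div_le_iff₀ hq, inv_pow, add_mul, inv_mul_cancel₀ hq.ne', one_div_mul_eq_div,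
      ← sub_le_iff_le_add, le_div_iff₀ hd0]
    linarith

namespace Polynomial

variable {k : Type*} [Field k]

lemma tendsto_sum_coDim_div_pow [IsAlgClosed k] {p : ℕ} (hp : p.Prime) [CharP k p]
    {d : Fin 3 → ℕ} (hd : ∀ j, 0 < d j) (i : ∀ j, Fin (d j)) :
    Filter.Tendsto (fun e : ℕ => (∑ n ∈ Finset.range (3 * p ^ e),
        (coDim k (diagExponent d (p ^ e) fun j => i j) n : ℝ)) / (p : ℝ) ^ (2 * e)) Filter.atTop
      (nhds (1 / 4 * (2 * (1 / (d 0 : ℝ) * (1 / d 1) + 1 / d 0 * (1 / d 2) + 1 / d 1 * (1 / d 2))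
        - ((1 / (d 0 : ℝ)) ^ 2 + (1 / d 1) ^ 2 + (1 / d 2) ^ 2)
        + hanDelta p ![1 / (d 0 : ℝ), 1 / d 1, 1 / d 2] ^ 2))) := by
  have hp0 : (p : ℝ) ≠ 0 := by exact_mod_cast hp.ne_zero
  have hlim (j : Fin 3) : Filter.Tendsto
      (fun e : ℕ => (diagExponent d (p ^ e) (fun j => i j) j : ℝ) / (p : ℝ) ^ e) Filter.atTop
      (nhds (1 / (d j : ℝ))) :=
    tendsto_ceilDiv_div_pow hp.one_lt (hd j) (i j).2
  have hdelta := ((continuous_hanDelta hp.pos).tendsto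
    ![1 / (d 0 : ℝ), 1 / d 1, 1 / d 2]).comp (tendsto_pi_nhds.mpr fun j => show
      Filter.Tendsto (fun e : ℕ => (diagExponent d (p ^ e) (fun j => i j) j : ℝ) / (p : ℝ) ^ e)
        Filter.atTop _ by fin_cases j <;> exact hlim _)
  refine Filter.Tendsto.congr' ?_ ((((((hlim 0).mul (hlim 1)).add ((hlim 0).mul (hlim 2))).add
    ((hlim 1).mul (hlim 2))).const_mul 2 |>.sub ((((hlim 0).pow 2).add ((hlim 1).pow 2)).add
    ((hlim 2).pow 2)) |>.add (hdelta.pow 2)).const_mul (1 / 4))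
  obtain ⟨e₀, he₀⟩ := (Filter.eventually_atTop.mp
    ((tendsto_pow_atTop_atTop_of_one_lt hp.one_lt).eventually_gt_atTop (d 0 + d 1 + d 2)))
  filter_upwards [Filter.eventually_ge_atTop e₀] with e he
  have hlt := he₀ e he
  set w := diagExponent d (p ^ e) (fun j => i j) with hw
  have hpos (j) : 0 < w j := by
    have h1 : p ^ e - i j ≤ d j * w j := (ceilDiv_le_iff_le_mul (hd j)).mp le_rfl
    have h2 : d j ≤ d 0 + d 1 + d 2 := by fin_cases j <;> simp <;> omega
    have h3 := (i j).2
    exact Nat.pos_of_mul_pos_left (a := d j) (by omega)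
  have hle (j) : w j ≤ p ^ e :=
    (ceilDiv_le_iff_le_mul (hd j)).mpr
      ((Nat.sub_le _ _).trans (Nat.le_mul_of_pos_left _ (hd j)))
  have hsum := four_mul_sum_coDim (k := k) hp hpos (N := 3 * p ^ e)
    (by have := hle 0; have := hle 1; have := hle 2; omega)
  have hscale : hanDelta p (fun j => (w j : ℝ) / (p : ℝ) ^ e)
      = hanDelta p ![(w 0 : ℝ), w 1, w 2] / (p : ℝ) ^ e := by
    rw [div_eq_inv_mul, ← zpow_natCast, ← zpow_neg, ← hanDelta_zpow_mul hp.pos]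
    congr 1
    ext j
    rw [zpow_neg, ← div_eq_inv_mul]
    fin_cases j <;> rfl
  simp only [Function.comp_apply]
  rw [hscale, pow_mul', eq_div_iff (by positivity), ← mul_right_inj' (four_ne_zero (α := ℝ)), hsum]
  field_simp

theorem tendsto_diagHK_div_pow [IsAlgClosed k] {p : ℕ} (hp : p.Prime) [CharP k p]
    {d₁ d₂ d₃ : ℕ} (h₁ : 0 < d₁) (h₂ : 0 < d₂) (h₃ : 0 < d₃) :
    Filter.Tendsto (fun e : ℕ => (diagHK k d₁ d₂ d₃ (p ^ e) : ℝ) / (p : ℝ) ^ (2 * e))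
      Filter.atTop (nhds (hkmDiag p d₁ d₂ d₃)) := by
  have hd : ∀ j, 0 < ![d₁, d₂, d₃] j := fun j => by fin_cases j <;> assumption
  have h₁' : (d₁ : ℝ) ≠ 0 := by exact_mod_cast h₁.ne'
  have h₂' : (d₂ : ℝ) ≠ 0 := by exact_mod_cast h₂.ne'
  have h₃' : (d₃ : ℝ) ≠ 0 := by exact_mod_cast h₃.ne'
  convert tendsto_finsetSum Finset.univ fun i _ => tendsto_sum_coDim_div_pow (k := k) hp hd i
    using 2 with e
  · rw [diagHK_eq_sum h₁ h₂ h₃, ← Finset.sum_div]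
    push_cast
    rfl
  · rw [Finset.sum_const, Finset.card_univ, Fintype.card_pi, nsmul_eq_mul, hkmDiag]
    simp_rw [Fintype.card_fin]
    simp only [Fin.prod_univ_three, Matrix.cons_val]
    push_cast
    field_simp
    ring

end Polynomial

lemma hkmDiag_swap₁₂ {p : ℕ} (hp : 0 < p) (d₁ d₂ d₃ : ℕ) :
    hkmDiag p d₁ d₂ d₃ = hkmDiag p d₂ d₁ d₃ := by
  rw [hkmDiag, hkmDiag, hanDelta_swap₀₁ hp]
  ring

lemma hkmDiag_swap₁₃ {p : ℕ} (hp : 0 < p) (d₁ d₂ d₃ : ℕ) :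
    hkmDiag p d₁ d₂ d₃ = hkmDiag p d₃ d₂ d₁ := by
  rw [hkmDiag, hkmDiag, hanDelta_swap₀₂ hp]
  ring

lemma hkmDiag_eq_of_add_le {p : ℕ} (hp : 1 < p) {d₁ d₂ d₃ : ℕ} (h₁ : 0 < d₁) (h₂ : 0 < d₂)
    (h₃ : 0 < d₃) (h : 1 / (d₂ : ℝ) + 1 / (d₃ : ℝ) ≤ 1 / (d₁ : ℝ)) :
    hkmDiag p d₁ d₂ d₃ = d₁ ∧ (d₁ : ℝ) ≤ d₂ ∧ (d₁ : ℝ) ≤ d₃ := by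
  have h₁' : (0 : ℝ) < d₁ := by exact_mod_cast h₁
  have h₂' : (0 : ℝ) < d₂ := by exact_mod_cast h₂
  have h₃' : (0 : ℝ) < d₃ := by exact_mod_cast h₃
  have hpos₂ := one_div_pos.mpr h₂'
  have hpos₃ := one_div_pos.mpr h₃'
  refine ⟨?_, (one_div_le_one_div h₂' h₁').mp (by linarith),
    (one_div_le_one_div h₃' h₁').mp (by linarith)⟩
  rw [hkmDiag, hanDelta_eq_of_add_le hp hpos₂.le hpos₃.le h]
  field_simp
  ring

/-- The Hilbert–Kunz multiplicity of `k[U,V,W]/(U^{d₁}+V^{d₂}+W^{d₃})` equals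
`(1/4)·(2d₁+2d₂+2d₃ - d₁d₂/d₃ - d₁d₃/d₂ - d₂d₃/d₁ + d₁d₂d₃·δ(1/d₁,1/d₂,1/d₃)²)`;
in particular, if `(1/d₁,1/d₂,1/d₃)` fails the strict triangle inequality, this value
is `min{d₁,d₂,d₃}`. -/
theorem stmt9 (k : Type*) [Field k] [IsAlgClosed k] (p : ℕ) (hp : p.Prime) [CharP k p]
    (d₁ d₂ d₃ : ℕ) (h₁ : 2 ≤ d₁) (h₂ : 2 ≤ d₂) (h₃ : 2 ≤ d₃) :
    Filter.Tendsto (fun e : ℕ => (diagHK k d₁ d₂ d₃ (p ^ e) : ℝ) / (p : ℝ) ^ (2 * e))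
        Filter.atTop (nhds (hkmDiag p d₁ d₂ d₃)) ∧
      (¬ (1 / (d₁ : ℝ) < 1 / (d₂ : ℝ) + 1 / (d₃ : ℝ) ∧
            1 / (d₂ : ℝ) < 1 / (d₁ : ℝ) + 1 / (d₃ : ℝ) ∧
            1 / (d₃ : ℝ) < 1 / (d₁ : ℝ) + 1 / (d₂ : ℝ)) →
        hkmDiag p d₁ d₂ d₃ = min (d₁ : ℝ) (min (d₂ : ℝ) (d₃ : ℝ))) := by
  have h₁' : 0 < d₁ := by omega
  have h₂' : 0 < d₂ := by omega
  have h₃' : 0 < d₃ := by omega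
  refine ⟨Polynomial.tendsto_diagHK_div_pow hp h₁' h₂' h₃', fun h => ?_⟩
  rw [not_and_or, not_and_or, not_lt, not_lt, not_lt] at h
  obtain h | h | h := h
  · obtain ⟨h4, h5, h6⟩ := hkmDiag_eq_of_add_le hp.one_lt h₁' h₂' h₃' h
    rw [h4, min_eq_left (le_min h5 h6)]
  · obtain ⟨h4, h5, h6⟩ := hkmDiag_eq_of_add_le hp.one_lt h₂' h₁' h₃' h
    rw [hkmDiag_swap₁₂ hp.pos, h4, min_eq_left h6, min_eq_right h5]
  · obtain ⟨h4, h5, h6⟩ := hkmDiag_eq_of_add_le hp.one_lt h₃' h₂' h₁' (by rwa [add_comm])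
    rw [hkmDiag_swap₁₃ hp.pos, h4, min_eq_right h5, min_eq_right h6]
end
end
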